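/- There exists an absolute constant c₁ > 0 such that for every τ > 0 and every real random variable ξ with E ξ = 0 whose distribution F belongs to the class A₁(τ), there exists a coupling π of F and the Gaussian law Φ_F (with the same mean 0 and the same variance as F) satisfying ∫ exp(|x − y|/(c₁ τ)) dπ(x,y) ≤ c₁. -/

import Mathlib

open MeasureTheory ProbabilityTheory

noncomputable section

/-- `φ` is the cumulant generating function (analytic logarithm of the Laplace transform,
normalized by `φ 0 = 0`) of `μ` on the disc `{z : ‖z‖ * τ < 1}`, with third derivative
bounded by `τ · Var μ`.  This is the defining property of the class `A₁(τ)`. -/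
def IsCGF (φ : ℂ → ℂ) (τ : ℝ) (μ : Measure ℝ) : Prop :=
  φ 0 = 0 ∧ ∀ z : ℂ, ‖z‖ * τ < 1 →
    Integrable (fun x : ℝ => Complex.exp (z * x)) μ ∧
    Complex.exp (φ z) = ∫ x : ℝ, Complex.exp (z * x) ∂μ ∧
    AnalyticAt ℂ φ z ∧
    ‖iteratedDeriv 3 φ z‖ ≤ τ * variance id μ

/-- The class `A₁(τ)` of distributions on `ℝ`. -/
def MemA1 (τ : ℝ) (μ : Measure ℝ) : Prop := ∃ φ : ℂ → ℂ, IsCGF φ τ μ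

/-- `π` is a coupling of `F` and `G`. -/
def IsCoupling (π : Measure (ℝ × ℝ)) (F G : Measure ℝ) : Prop :=
  π.map Prod.fst = F ∧ π.map Prod.snd = G


/-- Working form of the class `A₁(τ)`, with explicit derivatives. -/
structure Nice (τ : ℝ) (F : Measure ℝ) (f f1 f2 f3 : ℂ → ℂ) : Prop where
  zero : f 0 = 0
  d1 : ∀ z : ℂ, ‖z‖ * τ < 1 → HasDerivAt f (f1 z) z
  d2 : ∀ z : ℂ, ‖z‖ * τ < 1 → HasDerivAt f1 (f2 z) z
  d3 : ∀ z : ℂ, ‖z‖ * τ < 1 → HasDerivAt f2 (f3 z) z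
  bd : ∀ z : ℂ, ‖z‖ * τ < 1 → ‖f3 z‖ ≤ τ * variance id F
  int : ∀ z : ℂ, ‖z‖ * τ < 1 → Integrable (fun x : ℝ => Complex.exp (z * x)) F
  eq : ∀ z : ℂ, ‖z‖ * τ < 1 → Complex.exp (f z) = ∫ x : ℝ, Complex.exp (z * x) ∂F

lemma IsCGF.nice {φ : ℂ → ℂ} {τ : ℝ} {F : Measure ℝ} (h : IsCGF φ τ F) :
    Nice τ F φ (deriv φ) (deriv (deriv φ)) (deriv (deriv (deriv φ))) := by
  obtain ⟨h0, h⟩ := h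
  refine ⟨h0, fun z hz => ?_, fun z hz => ?_, fun z hz => ?_, fun z hz => ?_,
    fun z hz => (h z hz).1, fun z hz => (h z hz).2.1⟩
  · exact (h z hz).2.2.1.differentiableAt.hasDerivAt
  · exact (h z hz).2.2.1.deriv.differentiableAt.hasDerivAt
  · exact (h z hz).2.2.1.deriv.deriv.differentiableAt.hasDerivAt
  · have := (h z hz).2.2.2
    rwa [iteratedDeriv_succ, iteratedDeriv_succ, iteratedDeriv_one] at this

lemma Nice.scale {τ : ℝ} {F : Measure ℝ} {f f1 f2 f3 : ℂ → ℂ} (h : Nice τ F f f1 f2 f3)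
    (a : ℝ) (ha : a ≠ 0) :
    Nice (|a| * τ) (F.map (fun x => a * x)) (fun z => f (a * z)) (fun z => a * f1 (a * z))
      (fun z => a * (a * f2 (a * z))) (fun z => a * (a * (a * f3 (a * z)))) := by
  have key : ∀ z : ℂ, ‖z‖ * (|a| * τ) < 1 → ‖(a : ℂ) * z‖ * τ < 1 := by
    intro z hz
    rw [norm_mul, Complex.norm_real, Real.norm_eq_abs]
    calc |a| * ‖z‖ * τ = ‖z‖ * (|a| * τ) := by ring
      _ < 1 := hz
  have hd : ∀ {g g' : ℂ → ℂ} (z : ℂ), HasDerivAt g (g' (a * z)) (a * z) →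
      HasDerivAt (fun z => g (a * z)) (a * g' (a * z)) z := by
    intro g g' z hg
    have h1 : HasDerivAt (fun z : ℂ => (a : ℂ) * z) a z := by
      simpa using (hasDerivAt_id z).const_mul (a : ℂ)
    have := hg.comp z h1
    rw [mul_comm]
    exact this
  have hm : Measurable (fun x : ℝ => a * x) := by fun_prop
  have hvar : variance id (F.map (fun x => a * x)) = a ^ 2 * variance id F := by
    rw [variance_map aemeasurable_id hm.aemeasurable, ← variance_const_mul]
    rfl
  refine ⟨by simpa using h.zero, fun z hz => hd z (h.d1 _ (key z hz)),
    fun z hz => (hd z (h.d2 _ (key z hz))).const_mul _,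
    fun z hz => ((hd z (h.d3 _ (key z hz))).const_mul _).const_mul _, fun z hz => ?_,
    fun z hz => ?_, fun z hz => ?_⟩
  · rw [hvar]
    have := h.bd _ (key z hz)
    simp only [norm_mul, Complex.norm_real, Real.norm_eq_abs]
    calc |a| * (|a| * (|a| * ‖f3 (a * z)‖)) ≤ |a| * (|a| * (|a| * (τ * variance id F))) := by
          gcongr
      _ = |a| * τ * (|a| ^ 2 * variance id F) := by ring
      _ = _ := by rw [sq_abs]
  · rw [integrable_map_measure (by fun_prop) hm.aemeasurable]
    have := h.int _ (key z hz)
    refine this.congr (Filter.Eventually.of_forall fun x => ?_)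
    simp only [Function.comp]
    push_cast
    ring_nf
  · rw [integral_map hm.aemeasurable (by fun_prop), h.eq _ (key z hz)]
    congr 1
    ext x
    push_cast
    ring_nf

section
variable {F : Measure ℝ} {f f1 f2 f3 : ℂ → ℂ} {τ : ℝ}

lemma Nice.mem_int (h : Nice τ F f f1 f2 f3) (hτ : 0 < τ) {z : ℂ} (hz : ‖z‖ * τ < 1) :
    z.re ∈ interior (integrableExpSet id F) := by
  have hsub : Set.Ioo (-(1 / τ)) (1 / τ) ⊆ integrableExpSet id F := by
    intro t ht
    have h1 : ‖(t : ℂ)‖ * τ < 1 := by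
      rw [Complex.norm_real, Real.norm_eq_abs, ← lt_div_iff₀ hτ]
      exact abs_lt.2 ht
    have := (h.int t h1).norm
    refine this.congr (Filter.Eventually.of_forall fun x => ?_)
    simp [Complex.norm_exp]
  refine interior_maximal hsub isOpen_Ioo ?_
  have : |z.re| < 1 / τ := by
    rw [lt_div_iff₀ hτ]
    exact lt_of_le_of_lt (mul_le_mul_of_nonneg_right (Complex.abs_re_le_norm z) hτ.le) hz
  exact abs_lt.1 this

lemma ball_nhds {z : ℂ} (hz : ‖z‖ * τ < 1) : ∀ᶠ w : ℂ in nhds z, ‖w‖ * τ < 1 := by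
  have : Continuous fun w : ℂ => ‖w‖ * τ := by fun_prop
  exact this.continuousAt.eventually_lt continuousAt_const hz

lemma Nice.M1 (h : Nice τ F f f1 f2 f3) (hτ : 0 < τ) {z : ℂ} (hz : ‖z‖ * τ < 1) :
    ∫ x : ℝ, (x : ℂ) * Complex.exp (z * x) ∂F = Complex.exp (f z) * f1 z := by
  have A := hasDerivAt_integral_pow_mul_exp (h.mem_int hτ hz) 0
  have B := (h.d1 z hz).cexp
  have : (fun z : ℂ => Complex.exp (f z)) =ᶠ[nhds z]
      (fun z : ℂ => ∫ x : ℝ, ((id x : ℝ) : ℂ) ^ 0 * Complex.exp (z * (id x : ℝ)) ∂F) := by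
    filter_upwards [ball_nhds hz] with w hw
    rw [h.eq w hw]
    simp
  have := (A.congr_of_eventuallyEq this).unique B
  simpa using this

lemma Nice.M2 (h : Nice τ F f f1 f2 f3) (hτ : 0 < τ) {z : ℂ} (hz : ‖z‖ * τ < 1) :
    ∫ x : ℝ, (x : ℂ) ^ 2 * Complex.exp (z * x) ∂F
      = Complex.exp (f z) * (f1 z ^ 2 + f2 z) := by
  have A := hasDerivAt_integral_pow_mul_exp (h.mem_int hτ hz) 1
  have B := (h.d1 z hz).cexp.mul (h.d2 z hz)
  have : (fun z : ℂ => Complex.exp (f z) * f1 z) =ᶠ[nhds z]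
      (fun z : ℂ => ∫ x : ℝ, ((id x : ℝ) : ℂ) ^ 1 * Complex.exp (z * (id x : ℝ)) ∂F) := by
    filter_upwards [ball_nhds hz] with w hw
    rw [← h.M1 hτ hw]
    simp
  have := (A.congr_of_eventuallyEq this).unique B
  simp only [id, one_add_one_eq_two] at this
  rw [this]
  ring

lemma Nice.f1_zero (h : Nice τ F f f1 f2 f3) (hτ : 0 < τ) (hm : ∫ x : ℝ, x ∂F = 0) :
    f1 0 = 0 := by
  have := h.M1 hτ (z := 0) (by simp)
  simp only [zero_mul, Complex.exp_zero, mul_one, h.zero, one_mul] at this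
  rw [← this, integral_complex_ofReal, hm]
  simp

lemma Nice.f2_zero [IsProbabilityMeasure F] (h : Nice τ F f f1 f2 f3) (hτ : 0 < τ)
    (hm : ∫ x : ℝ, x ∂F = 0) :
    f2 0 = variance id F := by
  have := h.M2 hτ (z := 0) (by simp)
  simp only [zero_mul, Complex.exp_zero, mul_one, h.zero, one_mul, h.f1_zero hτ hm] at this
  rw [variance_of_integral_eq_zero aemeasurable_id (by simpa using hm)]
  simp only [id]
  rw [← integral_complex_ofReal]
  simp only [Complex.ofReal_pow]
  rw [this]
  ring

lemma Nice.real (h : Nice τ F f f1 f2 f3) (hτ : 0 < τ) {t : ℝ} (ht : ‖(t : ℂ)‖ * τ < 1) :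
    (∃ a : ℝ, f1 t = a) ∧ (∃ b : ℝ, f2 t = b) := by
  have e0 : Complex.exp (f t) = ((∫ x : ℝ, Real.exp (t * x) ∂F : ℝ) : ℂ) := by
    rw [h.eq t ht, ← integral_complex_ofReal]
    simp
  have e1 : Complex.exp (f t) * f1 t = ((∫ x : ℝ, x * Real.exp (t * x) ∂F : ℝ) : ℂ) := by
    rw [← h.M1 hτ ht, ← integral_complex_ofReal]
    simp
  have e2 : Complex.exp (f t) * (f1 t ^ 2 + f2 t)
      = ((∫ x : ℝ, x ^ 2 * Real.exp (t * x) ∂F : ℝ) : ℂ) := by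
    rw [← h.M2 hτ ht, ← integral_complex_ofReal]
    simp
  have hne := Complex.exp_ne_zero (f t)
  set A := ∫ x : ℝ, Real.exp (t * x) ∂F
  set B := ∫ x : ℝ, x * Real.exp (t * x) ∂F
  set C := ∫ x : ℝ, x ^ 2 * Real.exp (t * x) ∂F
  rw [e0] at e1 e2 hne
  have h1 : f1 t = ((B / A : ℝ) : ℂ) := by
    push_cast
    rw [eq_div_iff hne, mul_comm, e1]
  refine ⟨⟨B / A, h1⟩, C / A - (B / A) ^ 2, ?_⟩
  have : f1 t ^ 2 + f2 t = ((C / A : ℝ) : ℂ) := by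
    push_cast
    rw [eq_div_iff hne, mul_comm, e2]
  rw [h1] at this
  push_cast at this ⊢
  rw [← this]
  ring

/-- Taylor estimates. -/
lemma Nice.taylor (h : Nice τ F f f1 f2 f3) (hτ : 0 < τ) {z w : ℂ}
    (hz : (‖z‖ + ‖w‖) * τ < 1) :
    ‖f2 (z + w) - f2 z‖ ≤ τ * variance id F * ‖w‖ ∧
    ‖f1 (z + w) - f1 z - f2 z * w‖ ≤ τ * variance id F * ‖w‖ ^ 2 ∧
    ‖f (z + w) - f z - f1 z * w - f2 z * w ^ 2 / 2‖ ≤ τ * variance id F * ‖w‖ ^ 3 := by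
  have hV : 0 ≤ τ * variance id F := mul_nonneg hτ.le (variance_nonneg _ _)
  set K := τ * variance id F
  have hball : ∀ v : ℂ, v ∈ Metric.closedBall (0 : ℂ) ‖w‖ → ‖z + v‖ * τ < 1 := by
    intro v hv
    rw [mem_closedBall_zero_iff] at hv
    refine lt_of_le_of_lt ?_ hz
    gcongr
    exact (norm_add_le _ _).trans (by gcongr)
  have hconv : ∀ r : ℝ, Convex ℝ (Metric.closedBall (0 : ℂ) r) := fun r => convex_closedBall _ _
  have sh : ∀ {g g' : ℂ → ℂ} (v : ℂ), HasDerivAt g (g' (z + v)) (z + v) →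
      HasDerivAt (fun v => g (z + v)) (g' (z + v)) v := by
    intro g g' v hg
    exact hg.comp_const_add z v
  have s2 : ∀ v : ℂ, ‖v‖ ≤ ‖w‖ → ‖f2 (z + v) - f2 z‖ ≤ K * ‖v‖ := by
    intro v hv
    have hsub : Metric.closedBall (0 : ℂ) ‖v‖ ⊆ Metric.closedBall (0 : ℂ) ‖w‖ :=
      Metric.closedBall_subset_closedBall hv
    have := (hconv ‖v‖).norm_image_sub_le_of_norm_hasDerivWithin_le (f := fun v => f2 (z + v))
      (f' := fun v => f3 (z + v)) (C := K) (x := 0) (y := v)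
      (fun x hx => (sh x (h.d3 _ (hball x (hsub hx)))).hasDerivWithinAt)
      (fun x hx => h.bd _ (hball x (hsub hx))) (by simp) (by simp)
    simpa using this
  have s1 : ∀ v : ℂ, ‖v‖ ≤ ‖w‖ → ‖f1 (z + v) - f1 z - f2 z * v‖ ≤ K * ‖v‖ ^ 2 := by
    intro v hv
    have hsub : Metric.closedBall (0 : ℂ) ‖v‖ ⊆ Metric.closedBall (0 : ℂ) ‖w‖ :=
      Metric.closedBall_subset_closedBall hv
    have := (hconv ‖v‖).norm_image_sub_le_of_norm_hasDerivWithin_le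
      (f := fun v => f1 (z + v) - f1 z - f2 z * v)
      (f' := fun v => f2 (z + v) - f2 z) (C := K * ‖v‖) (x := 0) (y := v)
      (fun x hx => by
        have a := ((sh x (h.d2 _ (hball x (hsub hx)))).sub_const (f1 z)).sub
          ((hasDerivAt_id x).const_mul (f2 z))
        simp only [mul_one] at a
        exact a.hasDerivWithinAt)
      (fun x hx => by
        have hx' : ‖x‖ ≤ ‖v‖ := by simpa using hx
        exact (s2 x (hx'.trans hv)).trans (by gcongr)) (by simp) (by simp)
    simp only [add_zero, sub_self, mul_zero, sub_zero] at this
    calc _ ≤ _ := this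
      _ = _ := by ring
  have s0 : ∀ v : ℂ, ‖v‖ ≤ ‖w‖ →
      ‖f (z + v) - f z - f1 z * v - f2 z * v ^ 2 / 2‖ ≤ K * ‖v‖ ^ 3 := by
    intro v hv
    have hsub : Metric.closedBall (0 : ℂ) ‖v‖ ⊆ Metric.closedBall (0 : ℂ) ‖w‖ :=
      Metric.closedBall_subset_closedBall hv
    have := (hconv ‖v‖).norm_image_sub_le_of_norm_hasDerivWithin_le
      (f := fun v => f (z + v) - f z - f1 z * v - f2 z * v ^ 2 / 2)
      (f' := fun v => f1 (z + v) - f1 z - f2 z * v) (C := K * ‖v‖ ^ 2) (x := 0) (y := v)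
      (fun x hx => by
        have a := (((sh x (h.d1 _ (hball x (hsub hx)))).sub_const (f z)).sub
          ((hasDerivAt_id x).const_mul (f1 z))).sub
          ((((hasDerivAt_id x).pow 2).const_mul (f2 z)).div_const 2)
        refine (a.congr_deriv ?_).hasDerivWithinAt
        simp
        ring)
      (fun x hx => by
        have hx' : ‖x‖ ≤ ‖v‖ := by simpa using hx
        exact (s1 x (hx'.trans hv)).trans (by gcongr)) (by simp) (by simp)
    simp only [add_zero, sub_self, mul_zero, sub_zero] at this
    calc _ ≤ _ := by simpa using this
      _ = _ := by ring
  exact ⟨s2 w le_rfl, s1 w le_rfl, s0 w le_rfl⟩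
end


lemma norm_exp_sub_one_le' (w : ℂ) : ‖Complex.exp w - 1‖ ≤ ‖w‖ * Real.exp ‖w‖ := by
  have := Complex.norm_exp_sub_sum_le_norm_mul_exp w 1
  simpa using this

lemma Nice.tilt {F : Measure ℝ} [IsProbabilityMeasure F] {f f1 f2 f3 : ℂ → ℂ}
    (H : Nice (1 / 16) F f f1 f2 f3) (hm : ∫ x : ℝ, x ∂F = 0) {V : ℝ} (hVdef : variance id F = V)
    (hV : 0 < V) {h : ℝ} (hh : |h| ≤ 1) :
    ∃ m s L : ℝ, 0 < s ∧ |s ^ 2 - V| ≤ V * |h| / 16 ∧ |m - V * h| ≤ V * h ^ 2 / 16 ∧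
      |L - V * h ^ 2 / 2| ≤ V * |h| ^ 3 / 16 ∧
      Integrable (fun x : ℝ => Real.exp (h * x)) F ∧
      ∫ x : ℝ, Real.exp (h * x) ∂F = Real.exp L ∧
      ∀ t : ℝ, 0 < t → t ≤ 1 →
        ‖charFun (F.tilted (fun x => h * x)) t - Complex.exp (t * m * Complex.I - s ^ 2 * t ^ 2 / 2)‖
          ≤ s ^ 2 * t ^ 3 * Real.exp (-(s ^ 2 * t ^ 2 / 4)) := by
  have hτ : (0 : ℝ) < 1 / 16 := by norm_num
  have hnh : ‖(h : ℂ)‖ = |h| := by rw [Complex.norm_real, Real.norm_eq_abs]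
  have hball : ‖(h : ℂ)‖ * (1 / 16) < 1 := by rw [hnh]; linarith
  obtain ⟨⟨m, hm1⟩, ⟨b, hb⟩⟩ := H.real hτ hball
  have T0 := H.taylor hτ (z := 0) (w := h) (by rw [hnh, norm_zero]; linarith)
  rw [H.f1_zero hτ hm, H.f2_zero hτ hm, zero_add, H.zero, hVdef, hnh, hm1, hb] at T0
  obtain ⟨t2, t1, t0⟩ := T0
  have t2' : |b - V| ≤ V * |h| / 16 := by
    rw [← Complex.ofReal_sub, Complex.norm_real, Real.norm_eq_abs] at t2
    linarith
  have t1' : |m - V * h| ≤ V * h ^ 2 / 16 := by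
    rw [sub_zero, ← Complex.ofReal_mul, ← Complex.ofReal_sub, Complex.norm_real,
      Real.norm_eq_abs, sq_abs] at t1
    linarith
  have t0' : |(f h).re - V * h ^ 2 / 2| ≤ V * |h| ^ 3 / 16 := by
    have := (Complex.abs_re_le_norm _).trans t0
    have e : (f h - 0 - 0 * (h : ℂ) - (V : ℂ) * (h : ℂ) ^ 2 / 2).re = (f h).re - V * h ^ 2 / 2 := by
      have : ((V : ℂ) * (h : ℂ) ^ 2 / 2) = ((V * h ^ 2 / 2 : ℝ) : ℂ) := by push_cast; ring
      rw [this, Complex.sub_re, Complex.ofReal_re, zero_mul, sub_zero, sub_zero]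
    rw [e] at this
    linarith
  have hb15 : 15 / 16 * V ≤ b := by
    have := (abs_le.1 t2').1
    have : V * |h| ≤ V * 1 := by gcongr
    linarith
  have hbpos : 0 < b := by nlinarith
  have hs2 : Real.sqrt b ^ 2 = b := Real.sq_sqrt hbpos.le
  have hint : Integrable (fun x : ℝ => Real.exp (h * x)) F := by
    refine (H.int h hball).norm.congr (Filter.Eventually.of_forall fun x => ?_)
    simp [Complex.norm_exp]
  have hexpc : Complex.exp (f h) = ((∫ x : ℝ, Real.exp (h * x) ∂F : ℝ) : ℂ) := by
    rw [H.eq h hball, ← integral_complex_ofReal]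
    simp
  have hexp : ∫ x : ℝ, Real.exp (h * x) ∂F = Real.exp (f h).re := by
    have := congrArg norm hexpc
    rw [Complex.norm_exp, Complex.norm_real, Real.norm_eq_abs, abs_of_nonneg] at this
    · exact this.symm
    · exact integral_nonneg fun x => (Real.exp_pos _).le
  refine ⟨m, Real.sqrt b, (f h).re, Real.sqrt_pos.2 hbpos, by rwa [hs2], t1', t0', hint, hexp, ?_⟩
  intro t ht ht1
  have hcs : ((Real.sqrt b : ℝ) : ℂ) ^ 2 = (b : ℂ) := by rw [← Complex.ofReal_pow, hs2]
  rw [hcs, hs2]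
  have hnt : ‖(t : ℂ) * Complex.I‖ = t := by
    rw [norm_mul, Complex.norm_I, Complex.norm_real, Real.norm_eq_abs, abs_of_pos ht, mul_one]
  have T := (H.taylor hτ (z := h) (w := t * Complex.I) (by rw [hnh, hnt]; linarith)).2.2
  rw [hVdef, hnt, hm1, hb] at T
  have hball2 : ‖(h : ℂ) + t * Complex.I‖ * (1 / 16) < 1 := by
    have := norm_add_le (h : ℂ) (t * Complex.I)
    rw [hnh, hnt] at this
    linarith
  have hcf : charFun (F.tilted (fun x => h * x)) t
      = Complex.exp (f (h + t * Complex.I) - f h) := by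
    rw [charFun_apply_real, integral_tilted, Complex.exp_sub, H.eq _ hball2, hexpc,
      ← integral_div]
    congr 1
    ext x
    rw [Complex.real_smul]
    push_cast
    rw [div_mul_eq_mul_div, ← Complex.exp_add]
    congr 2
    ring
  set w := f (h + t * Complex.I) - f h - m * (t * Complex.I) - b * (t * Complex.I) ^ 2 / 2 with hw
  have hw2 : f (h + t * Complex.I) - f h = w + (t * m * Complex.I - b * t ^ 2 / 2) := by
    have : (t * Complex.I) ^ 2 = - (t : ℂ) ^ 2 := by rw [mul_pow, Complex.I_sq]; ring
    rw [hw, this]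
    ring
  have hnorm : ‖Complex.exp (t * m * Complex.I - b * t ^ 2 / 2)‖ = Real.exp (-(b * t ^ 2 / 2)) := by
    rw [Complex.norm_exp]
    congr 1
    have : (t * m * Complex.I - b * t ^ 2 / 2 : ℂ)
      = ((-(b * t ^ 2 / 2) : ℝ) : ℂ) + ((t * m : ℝ) : ℂ) * Complex.I := by
      push_cast; ring
    rw [this]
    simp [-Complex.ofReal_neg, -Complex.ofReal_mul, -Complex.ofReal_div, -Complex.ofReal_pow]
  rw [hcf, hw2, Complex.exp_add]
  have : Complex.exp w * Complex.exp (t * m * Complex.I - b * t ^ 2 / 2)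
      - Complex.exp (t * m * Complex.I - b * t ^ 2 / 2)
      = (Complex.exp w - 1) * Complex.exp (t * m * Complex.I - b * t ^ 2 / 2) := by ring
  rw [this, norm_mul, hnorm]
  have ht2 : t ^ 3 ≤ t ^ 2 := by nlinarith [sq_nonneg t]
  have hwb : ‖w‖ ≤ b * t ^ 3 / 15 := by
    have h3 : 0 < t ^ 3 := by positivity
    nlinarith
  have hwb2 : ‖w‖ ≤ b * t ^ 2 / 15 := by
    refine hwb.trans ?_
    have := mul_le_mul_of_nonneg_left ht2 hbpos.le
    linarith
  calc ‖Complex.exp w - 1‖ * Real.exp (-(b * t ^ 2 / 2))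
      ≤ (‖w‖ * Real.exp ‖w‖) * Real.exp (-(b * t ^ 2 / 2)) := by
        gcongr; exact norm_exp_sub_one_le' w
    _ = ‖w‖ * Real.exp (‖w‖ - (b * t ^ 2 / 2)) := by
        rw [mul_assoc, ← Real.exp_add]; rfl
    _ ≤ (b * t ^ 3) * Real.exp (-(b * t ^ 2 / 4)) := by
        have h3 : 0 < b * t ^ 3 := by positivity
        have h2 : 0 < b * t ^ 2 := by positivity
        gcongr
        · linarith
        · linarith


/-- Fejér kernel (unnormalized). -/
def fejer (u : ℝ) : ℝ := ∫ t in Set.Ioc (0 : ℝ) 1, (1 - t) * Real.cos (t * u)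

lemma fejer_eq {u : ℝ} (hu : u ≠ 0) : fejer u = (1 - Real.cos u) / u ^ 2 := by
  unfold fejer
  rw [← intervalIntegral.integral_of_le zero_le_one]
  have hd : ∀ t ∈ Set.uIcc (0 : ℝ) 1,
      HasDerivAt (fun t => (1 - t) * Real.sin (t * u) / u - Real.cos (t * u) / u ^ 2)
        ((1 - t) * Real.cos (t * u)) t := by
    intro t _
    have h1 : HasDerivAt (fun t : ℝ => t * u) u t := by simpa using (hasDerivAt_id t).mul_const u
    have h2 := ((((hasDerivAt_id t).const_sub 1).mul h1.sin).div_const u).sub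
      (h1.cos.div_const (u ^ 2))
    refine h2.congr_deriv ?_
    simp only [id]
    field_simp
    ring
  rw [intervalIntegral.integral_eq_sub_of_hasDerivAt hd]
  · simp
    field_simp
    ring
  · exact Continuous.intervalIntegrable (by fun_prop) _ _

lemma fejer_continuous : Continuous fejer := by
  have : fejer = fun u => ∫ t in (0 : ℝ)..1, (1 - t) * Real.cos (t * u) := by
    ext u
    rw [intervalIntegral.integral_of_le zero_le_one]; rfl
  rw [this]
  exact intervalIntegral.continuous_parametric_intervalIntegral_of_continuous' (by fun_prop) _ _

lemma fejer_zero : fejer 0 = 1 / 2 := by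
  unfold fejer
  rw [← intervalIntegral.integral_of_le zero_le_one]
  have : ∀ t ∈ Set.uIcc (0 : ℝ) 1, HasDerivAt (fun t : ℝ => t - t ^ 2 / 2)
      ((1 - t) * Real.cos (t * 0)) t := by
    intro t _
    refine ((hasDerivAt_id t).sub (((hasDerivAt_id t).pow 2).div_const 2)).congr_deriv ?_
    simp
  rw [intervalIntegral.integral_eq_sub_of_hasDerivAt this]
  · norm_num
  · exact Continuous.intervalIntegrable (by fun_prop) _ _

lemma fejer_nonneg (u : ℝ) : 0 ≤ fejer u := by
  rcases eq_or_ne u 0 with rfl | hu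
  · rw [fejer_zero]; norm_num
  · rw [fejer_eq hu]
    have := Real.cos_le_one u
    have : 0 ≤ 1 - Real.cos u := by linarith
    positivity

lemma fejer_le_one (u : ℝ) : fejer u ≤ 1 := by
  rcases eq_or_ne u 0 with rfl | hu
  · rw [fejer_zero]; norm_num
  · rw [fejer_eq hu, div_le_one (by positivity)]
    have := Real.one_sub_sq_div_two_le_cos (x := u)
    nlinarith [sq_nonneg u]

lemma fejer_le (u : ℝ) : fejer u ≤ 3 * (1 + u ^ 2)⁻¹ := by
  rw [← div_eq_mul_inv, le_div_iff₀ (by positivity)]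
  have h1 := fejer_le_one u
  have h2 : fejer u * u ^ 2 ≤ 2 := by
    rcases eq_or_ne u 0 with rfl | hu
    · simp
    · rw [fejer_eq hu, div_mul_cancel₀ _ (by positivity)]
      linarith [Real.neg_one_le_cos u]
  linarith

lemma fejer_integrable : Integrable fejer := by
  refine (integrable_inv_one_add_sq.const_mul 3).mono'
    fejer_continuous.aestronglyMeasurable (Filter.Eventually.of_forall fun u => ?_)
  rw [Real.norm_eq_abs, abs_of_nonneg (fejer_nonneg u)]
  exact fejer_le u

lemma fejer_integral_pos : 0 < ∫ u, fejer u := by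
  rw [integral_pos_iff_support_of_nonneg fejer_nonneg fejer_integrable]
  have ho : IsOpen (Function.support fejer) := fejer_continuous.isOpen_support
  refine ho.measure_pos _ ⟨0, ?_⟩
  rw [Function.mem_support, fejer_zero]; norm_num

lemma fejer_cutoff : ∃ r : ℝ, 0 < r ∧
    3 / 4 * (∫ u, fejer u) ≤ ∫ u in Set.Ioc (-r) r, fejer u := by
  have h := intervalIntegral_tendsto_integral fejer_integrable Filter.tendsto_neg_atTop_atBot
    (Filter.tendsto_id (α := ℝ))
  have h2 : ∀ᶠ r in (Filter.atTop : Filter ℝ),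
      3 / 4 * (∫ u, fejer u) < ∫ u in (-r)..(id r), fejer u :=
    h.eventually_const_lt (by linarith [fejer_integral_pos])
  obtain ⟨r, hr, hr0⟩ := (h2.and (Filter.eventually_gt_atTop 0)).exists
  refine ⟨r, hr0, ?_⟩
  rw [intervalIntegral.integral_of_le (by simp only [id]; linarith)] at hr
  exact hr.le

/-- Step A. -/
lemma fejer_stepA (ν : Measure ℝ) [IsProbabilityMeasure ν] (a b : ℝ) (hab : a ≤ b) :
    ∫ u, fejer u * (ν.real (Set.Iio (b - u)) - ν.real (Set.Iio (a - u)))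
      = ∫ x in Set.Ioc a b, ∫ y, fejer (x - y) ∂ν := by
  have h1 : ∀ u, fejer u * (ν.real (Set.Iio (b - u)) - ν.real (Set.Iio (a - u)))
      = ∫ y, fejer u * (Set.Ico a b).indicator (fun _ => (1 : ℝ)) (y + u) ∂ν := by
    intro u
    rw [integral_const_mul]
    congr 1
    have : (fun y => (Set.Ico a b).indicator (fun _ => (1 : ℝ)) (y + u))
        = (Set.Ico (a - u) (b - u)).indicator (fun _ => (1 : ℝ)) := by
      ext y
      simp only [Set.indicator, Set.mem_Ico, sub_le_iff_le_add, lt_sub_iff_add_lt]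
    have hd : Set.Ico (a - u) (b - u) = Set.Iio (b - u) \ Set.Iio (a - u) := by
      ext y
      simp
    rw [this, integral_indicator_const _ measurableSet_Ico, smul_eq_mul, mul_one,
      hd, measureReal_sdiff (Set.Iio_subset_Iio (by linarith)) measurableSet_Iio]
  simp_rw [h1]
  rw [integral_integral_swap]
  · have h2 : ∀ y, ∫ u, fejer u * (Set.Ico a b).indicator (fun _ => (1 : ℝ)) (y + u)
        = ∫ x in Set.Ioc a b, fejer (x - y) := by
      intro y
      rw [← integral_Ico_eq_integral_Ioc, ← integral_indicator measurableSet_Ico,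
        ← integral_add_right_eq_self ((Set.Ico a b).indicator fun x => fejer (x - y)) y]
      congr 1
      ext u
      simp only [Set.indicator, add_comm y u, add_sub_cancel_right]
      split_ifs <;> simp
    simp_rw [h2]
    rw [integral_integral_swap]
    have : Integrable (fun _ : ℝ × ℝ => (1 : ℝ)) (ν.prod (volume.restrict (Set.Ioc a b))) :=
      integrable_const _
    refine this.mono' ?_ (Filter.Eventually.of_forall fun p => ?_)
    · exact (fejer_continuous.comp (by fun_prop : Continuous fun p : ℝ × ℝ => p.2 - p.1)).aestronglyMeasurable
    · simp only [Function.uncurry]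
      rw [Real.norm_eq_abs, abs_of_nonneg (fejer_nonneg _)]
      exact fejer_le_one _
  · refine (fejer_integrable.comp_fst ν).mono' ?_ (Filter.Eventually.of_forall fun p => ?_)
    · refine (Measurable.mul ?_ ?_).aestronglyMeasurable
      · exact fejer_continuous.measurable.comp measurable_fst
      · exact (measurable_const.indicator measurableSet_Ico).comp
          (measurable_snd.add measurable_fst)
    · simp only [Function.uncurry]
      rw [norm_mul, Real.norm_eq_abs, abs_of_nonneg (fejer_nonneg _)]
      refine mul_le_of_le_one_right (fejer_nonneg _) ?_
      simp only [Set.indicator]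
      split_ifs <;> simp

/-- Step B. -/
lemma fejer_stepB (ν : Measure ℝ) [IsProbabilityMeasure ν] (x : ℝ) :
    ∫ y, fejer (x - y) ∂ν = ∫ t in Set.Ioc (0 : ℝ) 1,
      (1 - t) * (Complex.exp (-(t * Complex.I) * x) * charFun ν t).re := by
  unfold fejer
  rw [integral_integral_swap]
  · congr 1
    ext t
    rw [integral_const_mul]
    congr 1
    rw [charFun_apply_real, ← integral_const_mul, ← RCLike.re_eq_complex_re, ← integral_re]
    · congr 1
      ext y
      rw [← Complex.exp_add]
      have : (-(t * Complex.I) * x + t * y * Complex.I : ℂ)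
          = ((-(t * (x - y)) : ℝ) : ℂ) * Complex.I := by push_cast; ring
      rw [this, RCLike.re_eq_complex_re, Complex.exp_ofReal_mul_I_re, Real.cos_neg]
    · refine Integrable.const_mul ?_ _
      have : Integrable (fun _ : ℝ => (1 : ℝ)) ν := integrable_const _
      refine this.mono' (by fun_prop) (Filter.Eventually.of_forall fun y => ?_)
      rw [← Complex.ofReal_mul, Complex.norm_exp_ofReal_mul_I]
  · have : Integrable (fun _ : ℝ × ℝ => (1 : ℝ)) (ν.prod (volume.restrict (Set.Ioc (0 : ℝ) 1))) :=
      integrable_const _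
    refine this.mono' ?_ ?_
    · refine Continuous.aestronglyMeasurable ?_
      simp only [Function.uncurry_def]
      fun_prop
    · have : ∀ᵐ p : ℝ × ℝ ∂(ν.prod (volume.restrict (Set.Ioc (0 : ℝ) 1))), p.2 ∈ Set.Ioc (0 : ℝ) 1 := by
        have := Measure.quasiMeasurePreserving_snd (μ := ν) (ν := volume.restrict (Set.Ioc (0 : ℝ) 1))
        exact this.ae (ae_restrict_mem measurableSet_Ioc)
      filter_upwards [this] with p hp
      simp only [Function.uncurry]
      rw [norm_mul, Real.norm_eq_abs, Real.norm_eq_abs]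
      have h1 : |1 - p.2| ≤ 1 := abs_le.2 ⟨by linarith [hp.2], by linarith [hp.1]⟩
      have h2 := Real.abs_cos_le_one (p.2 * (x - p.1))
      calc _ ≤ (1 : ℝ) * 1 := by gcongr
        _ = 1 := one_mul 1


lemma fejer_stepC (μ ν : Measure ℝ) [IsProbabilityMeasure μ] [IsProbabilityMeasure ν] {s : ℝ}
    (hs : 0 < s)
    (hw : ∀ t : ℝ, 0 < t → t ≤ 1 →
      ‖charFun μ t - charFun ν t‖ ≤ s ^ 2 * t ^ 3 * Real.exp (-(s ^ 2 * t ^ 2 / 4)))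
    (a b : ℝ) (hab : a ≤ b) :
    |(∫ x in Set.Ioc a b, ∫ y, fejer (x - y) ∂μ) - ∫ x in Set.Ioc a b, ∫ y, fejer (x - y) ∂ν|
      ≤ 16 * Real.sqrt (8 * Real.pi) / s := by
  have hcμ : Continuous (charFun μ) := continuous_charFun
  have hcν : Continuous (charFun ν) := continuous_charFun
  set w : ℝ → ℂ := fun t => charFun μ t - charFun ν t with hwdef
  have hwc : Continuous w := hcμ.sub hcν
  have hfc : ∀ (ρ : Measure ℝ) [IsProbabilityMeasure ρ],
      IntegrableOn (fun x => ∫ y, fejer (x - y) ∂ρ) (Set.Ioc a b) := by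
    intro ρ _
    have hj : Integrable (fun p : ℝ × ℝ => fejer (p.1 - p.2))
        ((volume.restrict (Set.Ioc a b)).prod ρ) := by
      have : Integrable (fun _ : ℝ × ℝ => (1 : ℝ)) ((volume.restrict (Set.Ioc a b)).prod ρ) :=
        integrable_const _
      refine this.mono' ?_ (Filter.Eventually.of_forall fun p => ?_)
      · exact (fejer_continuous.comp
          (by fun_prop : Continuous fun p : ℝ × ℝ => p.1 - p.2)).aestronglyMeasurable
      · rw [Real.norm_eq_abs, abs_of_nonneg (fejer_nonneg _)]
        exact fejer_le_one _
    exact hj.integral_prod_left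
  rw [← integral_sub (hfc μ) (hfc ν)]
  have hti : ∀ (x : ℝ) (g : ℝ → ℂ), Continuous g → IntegrableOn (fun t : ℝ =>
      (1 - t) * (Complex.exp (-(t * Complex.I) * x) * g t).re) (Set.Ioc 0 1) := by
    intro x g hg
    have : Continuous (fun t : ℝ => (1 - t) * (Complex.exp (-(t * Complex.I) * x) * g t).re) := by
      fun_prop
    exact this.integrableOn_Ioc
  have e1 : ∀ x : ℝ, (∫ y, fejer (x - y) ∂μ) - (∫ y, fejer (x - y) ∂ν)
      = ∫ t in Set.Ioc (0 : ℝ) 1, (1 - t) * (Complex.exp (-(t * Complex.I) * x) * w t).re := by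
    intro x
    rw [fejer_stepB, fejer_stepB, ← integral_sub (hti x _ hcμ) (hti x _ hcν)]
    congr 1
    ext t
    simp only [hwdef, mul_sub, Complex.sub_re]
  simp_rw [e1]
  rw [integral_integral_swap]
  · have hb : ∀ t ∈ Set.Ioc (0 : ℝ) 1,
        ‖∫ x in Set.Ioc a b, (1 - t) * (Complex.exp (-(t * Complex.I) * x) * w t).re‖
          ≤ 16 * Real.exp (-(s ^ 2 / 8) * t ^ 2) := by
      intro t ht
      have ht0 := ht.1
      rw [integral_const_mul, ← intervalIntegral.integral_of_le hab]
      have hne : -((t : ℂ) * Complex.I) ≠ 0 := by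
        simp [ht0.ne']
      have e2 : ∫ x in a..b, (Complex.exp (-(t * Complex.I) * x) * w t).re
          = ((∫ x in a..b, Complex.exp (-(t * Complex.I) * x)) * w t).re := by
        rw [← intervalIntegral.integral_mul_const, intervalIntegral.integral_of_le hab,
          intervalIntegral.integral_of_le hab]
        have := integral_re (𝕜 := ℂ) (μ := volume.restrict (Set.Ioc a b))
          (f := fun x : ℝ => Complex.exp (-(t * Complex.I) * x) * w t)
          (by
            have : Continuous (fun x : ℝ => Complex.exp (-(t * Complex.I) * x) * w t) := by fun_prop
            exact this.integrableOn_Ioc)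
        exact this
      rw [e2, integral_exp_mul_complex hne]
      have hn1 : ∀ c : ℝ, ‖Complex.exp (-(t * Complex.I) * c)‖ = 1 := by
        intro c
        have : (-(t * Complex.I) * c : ℂ) = ((-(t * c) : ℝ) : ℂ) * Complex.I := by push_cast; ring
        rw [this, Complex.norm_exp_ofReal_mul_I]
      have hn2 : ‖(-((t : ℂ) * Complex.I))‖ = t := by
        rw [norm_neg, norm_mul, Complex.norm_I, Complex.norm_real, Real.norm_eq_abs,
          abs_of_pos ht0, mul_one]
      have hE : ‖(Complex.exp (-(t * Complex.I) * b) - Complex.exp (-(t * Complex.I) * a))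
          / (-((t : ℂ) * Complex.I))‖ ≤ 2 / t := by
        rw [norm_div, hn2]
        gcongr
        refine (norm_sub_le _ _).trans ?_
        rw [hn1, hn1]; norm_num
      have h1 : |1 - t| ≤ 1 := abs_le.2 ⟨by linarith [ht.2], by linarith [ht.1]⟩
      rw [norm_mul, Real.norm_eq_abs, Real.norm_eq_abs]
      have hX : s ^ 2 * t ^ 2 ≤ 8 * Real.exp (s ^ 2 * t ^ 2 / 8) := by
        have := Real.add_one_le_exp (s ^ 2 * t ^ 2 / 8)
        linarith
      calc |1 - t| * |_| ≤ 1 * (2 / t * (s ^ 2 * t ^ 3 * Real.exp (-(s ^ 2 * t ^ 2 / 4)))) := by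
            gcongr
            refine (Complex.abs_re_le_norm _).trans ?_
            rw [norm_mul]
            exact mul_le_mul hE (hw t ht.1 ht.2) (norm_nonneg _) (by positivity)
        _ = 2 * (s ^ 2 * t ^ 2) * Real.exp (-(s ^ 2 * t ^ 2 / 4)) := by field_simp
        _ ≤ 2 * (8 * Real.exp (s ^ 2 * t ^ 2 / 8)) * Real.exp (-(s ^ 2 * t ^ 2 / 4)) := by gcongr
        _ = 16 * (Real.exp (s ^ 2 * t ^ 2 / 8) * Real.exp (-(s ^ 2 * t ^ 2 / 4))) := by ring
        _ = 16 * Real.exp (-(s ^ 2 / 8) * t ^ 2) := by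
            rw [← Real.exp_add]
            congr 2
            ring
    have hgi : Integrable (fun t : ℝ => 16 * Real.exp (-(s ^ 2 / 8) * t ^ 2)) :=
      (integrable_exp_neg_mul_sq (by positivity)).const_mul 16
    rw [← Real.norm_eq_abs]
    calc _ ≤ ∫ t in Set.Ioc (0 : ℝ) 1, 16 * Real.exp (-(s ^ 2 / 8) * t ^ 2) := by
          refine norm_integral_le_of_norm_le hgi.integrableOn ?_
          filter_upwards [ae_restrict_mem measurableSet_Ioc] with t ht
          exact hb t ht
      _ ≤ ∫ t : ℝ, 16 * Real.exp (-(s ^ 2 / 8) * t ^ 2) :=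
          setIntegral_le_integral hgi (Filter.Eventually.of_forall fun t => by positivity)
      _ = 16 * Real.sqrt (8 * Real.pi) / s := by
          rw [integral_const_mul, integral_gaussian]
          have : Real.pi / (s ^ 2 / 8) = (8 * Real.pi) / s ^ 2 := by field_simp
          rw [this, Real.sqrt_div (by positivity), Real.sqrt_sq hs.le]
          ring
  · have hcont : Continuous (Function.uncurry fun (x t : ℝ) =>
        (1 - t) * (Complex.exp (-(t * Complex.I) * x) * w t).re) := by
      simp only [Function.uncurry_def]
      fun_prop
    rw [Measure.prod_restrict]
    have hK : IsCompact (Set.Icc a b ×ˢ Set.Icc (0 : ℝ) 1) := isCompact_Icc.prod isCompact_Icc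
    exact (hcont.continuousOn.integrableOn_compact hK).mono_set
      (Set.prod_mono Set.Ioc_subset_Icc_self Set.Ioc_subset_Icc_self)

lemma tendsto_Iio_atBot (ν : Measure ℝ) [IsProbabilityMeasure ν] :
    Filter.Tendsto (fun x => ν.real (Set.Iio x)) Filter.atBot (nhds 0) := by
  refine tendsto_of_tendsto_of_tendsto_of_le_of_le tendsto_const_nhds (tendsto_cdf_atBot ν)
    (fun x => measureReal_nonneg) (fun x => ?_)
  rw [cdf_eq_real]
  exact measureReal_mono Set.Iio_subset_Iic_self

lemma mono_Iio (ν : Measure ℝ) [IsProbabilityMeasure ν] :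
    Monotone (fun x => ν.real (Set.Iio x)) :=
  fun _ _ h => measureReal_mono (Set.Iio_subset_Iio h)

/-- Esseen inequality in the form needed. -/
lemma berry_esseen : ∃ C₀ : ℝ, 0 < C₀ ∧ ∀ (μ ν : Measure ℝ) [IsProbabilityMeasure μ]
    [IsProbabilityMeasure ν] (s : ℝ), 0 < s →
    (∀ x y : ℝ, x ≤ y → ν.real (Set.Iio y) - ν.real (Set.Iio x) ≤ (y - x) / s) →
    (∀ t : ℝ, 0 < t → t ≤ 1 →
      ‖charFun μ t - charFun ν t‖ ≤ s ^ 2 * t ^ 3 * Real.exp (-(s ^ 2 * t ^ 2 / 4))) →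
    ∀ x, |μ.real (Set.Iio x) - ν.real (Set.Iio x)| ≤ C₀ / s := by
  obtain ⟨r, hr, hcut⟩ := fejer_cutoff
  have hK := fejer_integral_pos
  set K := ∫ u, fejer u with hKdef
  set B₀ := 16 * Real.sqrt (8 * Real.pi) with hB₀
  have hB₀0 : 0 ≤ B₀ := by positivity
  refine ⟨3 / 2 * (2 * r + B₀ / (3 / 4 * K)), by positivity, ?_⟩
  intro μ ν _ _ s hs hlip hw
  set D : ℝ → ℝ := fun x => μ.real (Set.Iio x) - ν.real (Set.Iio x) with hD
  have hDm : Measurable D := (mono_Iio μ).measurable.sub (mono_Iio ν).measurable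
  have hD1 : ∀ x, |D x| ≤ 1 := by
    intro x
    have h1 : μ.real (Set.Iio x) ≤ 1 := measureReal_le_one
    have h2 : ν.real (Set.Iio x) ≤ 1 := measureReal_le_one
    have h3 : 0 ≤ μ.real (Set.Iio x) := measureReal_nonneg
    have h4 : 0 ≤ ν.real (Set.Iio x) := measureReal_nonneg
    exact abs_le.2 ⟨by simp only [hD]; linarith, by simp only [hD]; linarith⟩
  have hint : ∀ b, Integrable (fun u => fejer u * D (b - u)) := by
    intro b
    refine fejer_integrable.mono' ?_ (Filter.Eventually.of_forall fun u => ?_)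
    · exact (fejer_continuous.measurable.mul
        (hDm.comp (measurable_const.sub measurable_id))).aestronglyMeasurable
    · rw [norm_mul, Real.norm_eq_abs, abs_of_nonneg (fejer_nonneg _), Real.norm_eq_abs]
      exact mul_le_of_le_one_right (fejer_nonneg _) (hD1 _)
  have hintν : ∀ (ρ : Measure ℝ) [IsProbabilityMeasure ρ] (a b : ℝ),
      Integrable (fun u => fejer u * (ρ.real (Set.Iio (b - u)) - ρ.real (Set.Iio (a - u)))) := by
    intro ρ _ a b
    refine fejer_integrable.mono' ?_ (Filter.Eventually.of_forall fun u => ?_)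
    · exact (fejer_continuous.measurable.mul
        (((mono_Iio ρ).measurable.comp (measurable_const.sub measurable_id)).sub
        ((mono_Iio ρ).measurable.comp (measurable_const.sub measurable_id)))).aestronglyMeasurable
    · rw [norm_mul, Real.norm_eq_abs, abs_of_nonneg (fejer_nonneg _), Real.norm_eq_abs]
      refine mul_le_of_le_one_right (fejer_nonneg _) ?_
      have h1 : ρ.real (Set.Iio (b - u)) ≤ 1 := measureReal_le_one
      have h2 : ρ.real (Set.Iio (a - u)) ≤ 1 := measureReal_le_one
      have h3 : 0 ≤ ρ.real (Set.Iio (a - u)) := measureReal_nonneg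
      have h4 : 0 ≤ ρ.real (Set.Iio (b - u)) := measureReal_nonneg
      exact abs_le.2 ⟨by linarith, by linarith⟩
  have hdiff : ∀ a b, a ≤ b →
      |(∫ u, fejer u * D (b - u)) - ∫ u, fejer u * D (a - u)| ≤ B₀ / s := by
    intro a b hab
    have := fejer_stepC μ ν hs hw a b hab
    rw [← fejer_stepA μ a b hab, ← fejer_stepA ν a b hab,
      ← integral_sub (hintν μ a b) (hintν ν a b)] at this
    rw [← integral_sub (hint b) (hint a)]
    convert this using 3
    ext u
    simp only [hD]
    ring
  have hlim : Filter.Tendsto (fun a => ∫ u, fejer u * D (a - u)) Filter.atBot (nhds 0) := by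
    have : (0 : ℝ) = ∫ u : ℝ, (0 : ℝ) := by simp
    rw [this]
    refine tendsto_integral_filter_of_dominated_convergence fejer
      (Filter.Eventually.of_forall fun a => (hint a).aestronglyMeasurable)
      (Filter.Eventually.of_forall fun a => Filter.Eventually.of_forall fun u => ?_)
      fejer_integrable (Filter.Eventually.of_forall fun u => ?_)
    · rw [norm_mul, Real.norm_eq_abs, abs_of_nonneg (fejer_nonneg _), Real.norm_eq_abs]
      exact mul_le_of_le_one_right (fejer_nonneg _) (hD1 _)
    · have hDt : Filter.Tendsto D Filter.atBot (nhds 0) := by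
        simpa using (tendsto_Iio_atBot μ).sub (tendsto_Iio_atBot ν)
      have hsh : Filter.Tendsto (fun a : ℝ => a - u) Filter.atBot Filter.atBot := by
        simpa [sub_eq_add_neg] using Filter.tendsto_atBot_add_const_right Filter.atBot (-u) Filter.tendsto_id
      simpa using (hDt.comp hsh).const_mul (fejer u)
  have hS : ∀ b, |∫ u, fejer u * D (b - u)| ≤ B₀ / s := by
    intro b
    have h1 : Filter.Tendsto (fun a => |(∫ u, fejer u * D (b - u)) - ∫ u, fejer u * D (a - u)|)
        Filter.atBot (nhds |(∫ u, fejer u * D (b - u)) - 0|) :=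
      (tendsto_const_nhds.sub hlim).abs
    rw [sub_zero] at h1
    refine le_of_tendsto h1 ?_
    filter_upwards [Filter.eventually_le_atBot b] with a ha
    exact hdiff a b ha
  set M := ⨆ x, |D x| with hM
  have hbdd : BddAbove (Set.range fun x => |D x|) := ⟨1, by rintro _ ⟨x, rfl⟩; exact hD1 x⟩
  have hDM : ∀ x, |D x| ≤ M := fun x => le_ciSup hbdd x
  have hM0 : 0 ≤ M := (abs_nonneg _).trans (hDM 0)
  set Kin := ∫ u in Set.Ioc (-r) r, fejer u with hKin
  have hsplit : Kin + ∫ u in (Set.Ioc (-r) r)ᶜ, fejer u = K :=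
    integral_add_compl measurableSet_Ioc fejer_integrable
  have hKinpos : 0 < Kin := by linarith
  -- one-sided estimate for a general signed function
  have gen : ∀ (E : ℝ → ℝ) (d : ℝ), Integrable (fun u => fejer u * E u) →
      (∀ u ∈ Set.Ioc (-r) r, d - 2 * r / s ≤ E u) → (∀ u, -M ≤ E u) →
      |∫ u, fejer u * E u| ≤ B₀ / s → d ≤ 2 * r / s + B₀ / s / (3 / 4 * K) + M / 3 := by
    intro E d hE h1 h2 h3
    have h4 := (abs_le.1 h3).2
    rw [← integral_add_compl (measurableSet_Ioc (a := -r) (b := r)) hE] at h4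
    have h5 : Kin * (d - 2 * r / s) ≤ ∫ u in Set.Ioc (-r) r, fejer u * E u := by
      rw [hKin, ← integral_mul_const]
      refine setIntegral_mono_on (fejer_integrable.mul_const _).integrableOn hE.integrableOn
        measurableSet_Ioc fun u hu => ?_
      exact mul_le_mul_of_nonneg_left (h1 u hu) (fejer_nonneg u)
    have h6 : (∫ u in (Set.Ioc (-r) r)ᶜ, fejer u) * (-M)
        ≤ ∫ u in (Set.Ioc (-r) r)ᶜ, fejer u * E u := by
      rw [← integral_mul_const]
      refine setIntegral_mono (fejer_integrable.mul_const _).integrableOn hE.integrableOn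
        fun u => ?_
      exact mul_le_mul_of_nonneg_left (h2 u) (fejer_nonneg u)
    have hout : ∫ u in (Set.Ioc (-r) r)ᶜ, fejer u ≤ Kin / 3 := by linarith
    have h7 : Kin * (d - 2 * r / s) ≤ B₀ / s + Kin / 3 * M := by
      have := mul_le_mul_of_nonneg_right hout hM0
      linarith
    have h8 : d - 2 * r / s - M / 3 ≤ B₀ / s / Kin := by
      rw [le_div_iff₀ hKinpos]
      linarith
    have h9 : B₀ / s / Kin ≤ B₀ / s / (3 / 4 * K) := by gcongr
    linarith
  have key : ∀ x, |D x| ≤ 2 * r / s + B₀ / s / (3 / 4 * K) + M / 3 := by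
    intro x
    rcases le_total 0 (D x) with h0 | h0
    · rw [abs_of_nonneg h0]
      refine gen (fun u => D (x + r - u)) (D x) (hint _) (fun u hu => ?_)
        (fun u => (abs_le.1 (hDM _)).1) (hS _)
      have hle : x ≤ x + r - u := by linarith [hu.2]
      have a1 := hlip x (x + r - u) hle
      have a2 := mono_Iio μ hle
      have a3 : (x + r - u - x) / s ≤ 2 * r / s := by
        gcongr
        linarith [hu.1]
      simp only [hD] at a2 ⊢
      linarith
    · rw [abs_of_nonpos h0]
      have hi : Integrable (fun u => fejer u * (- D (x - r - u))) := by
        simpa using (hint (x - r)).neg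
      refine gen (fun u => - D (x - r - u)) (- D x) hi (fun u hu => ?_)
        (fun u => neg_le_neg (abs_le.1 (hDM _)).2) ?_
      · have hle : x - r - u ≤ x := by linarith [hu.1]
        have a1 := hlip (x - r - u) x hle
        have a2 := mono_Iio μ hle
        have a3 : (x - (x - r - u)) / s ≤ 2 * r / s := by
          gcongr
          linarith [hu.2]
        simp only [hD] at a2 ⊢
        linarith
      · have : ∫ u, fejer u * (- D (x - r - u)) = - ∫ u, fejer u * D (x - r - u) := by
          rw [← integral_neg]
          congr 1
          ext u
          ring
        rw [this, abs_neg]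
        exact hS _
  have hMle : M ≤ 2 * r / s + B₀ / s / (3 / 4 * K) + M / 3 := ciSup_le key
  intro x
  have : M ≤ 3 / 2 * (2 * r / s + B₀ / s / (3 / 4 * K)) := by linarith
  calc |D x| ≤ M := hDM x
    _ ≤ _ := this
    _ = _ := by field_simp


lemma sqrt_two_pi_le : Real.sqrt (2 * Real.pi) ≤ 3 := by
  rw [Real.sqrt_le_left (by norm_num)]
  have := Real.pi_lt_d2
  norm_num at this ⊢
  linarith

lemma one_le_sqrt_two_pi : 1 ≤ Real.sqrt (2 * Real.pi) := by
  rw [Real.one_le_sqrt]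
  have := Real.pi_gt_three
  linarith

lemma gpdf_eq (m : ℝ) {s : ℝ} (hs : 0 < s) (x : ℝ) :
    gaussianPDFReal m (Real.toNNReal (s ^ 2)) x
      = (Real.sqrt (2 * Real.pi))⁻¹ * s⁻¹ * Real.exp (-(x - m) ^ 2 / (2 * s ^ 2)) := by
  rw [gaussianPDFReal_def]
  simp only
  rw [Real.coe_toNNReal _ (by positivity), Real.sqrt_mul (by positivity), Real.sqrt_sq hs.le,
    mul_inv]

lemma toNNReal_sq_ne {s : ℝ} (hs : 0 < s) : Real.toNNReal (s ^ 2) ≠ 0 := by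
  have : 0 < Real.toNNReal (s ^ 2) := Real.toNNReal_pos.2 (by positivity)
  exact this.ne'

lemma gauss_real (m : ℝ) {s : ℝ} (hs : 0 < s) (A : Set ℝ) :
    (gaussianReal m (Real.toNNReal (s ^ 2))).real A
      = ∫ x in A, gaussianPDFReal m (Real.toNNReal (s ^ 2)) x := by
  rw [measureReal_def, gaussianReal_apply_eq_integral _ (toNNReal_sq_ne hs),
    ENNReal.toReal_ofReal]
  exact integral_nonneg fun x => gaussianPDFReal_nonneg _ _ _

lemma gauss_lip (m : ℝ) {s : ℝ} (hs : 0 < s) (x y : ℝ) (hxy : x ≤ y) :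
    (gaussianReal m (Real.toNNReal (s ^ 2))).real (Set.Iio y)
      - (gaussianReal m (Real.toNNReal (s ^ 2))).real (Set.Iio x) ≤ (y - x) / s := by
  have hd : Set.Ico x y = Set.Iio y \ Set.Iio x := by ext; simp
  rw [← measureReal_sdiff (Set.Iio_subset_Iio hxy) measurableSet_Iio, ← hd, gauss_real m hs]
  have hc : ∫ _z in Set.Ico x y, (1 / s : ℝ) = (y - x) / s := by
    rw [setIntegral_const, smul_eq_mul, measureReal_def, Real.volume_Ico,
      ENNReal.toReal_ofReal (by linarith)]
    ring
  rw [← hc]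
  refine setIntegral_mono (integrable_gaussianPDFReal _ _).integrableOn
    (integrableOn_const (by simp)) fun z => ?_
  rw [gpdf_eq m hs, one_div]
  have h1 : (Real.sqrt (2 * Real.pi))⁻¹ ≤ 1 := inv_le_one_of_one_le₀ one_le_sqrt_two_pi
  have h2 : Real.exp (-(z - m) ^ 2 / (2 * s ^ 2)) ≤ 1 := by
    rw [Real.exp_le_one_iff]
    have : 0 ≤ (z - m) ^ 2 / (2 * s ^ 2) := by positivity
    rw [neg_div]; linarith
  calc _ ≤ 1 * s⁻¹ * 1 := by gcongr
    _ = s⁻¹ := by ring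

lemma gauss_lower {s : ℝ} (hs : 0 < s) (x y : ℝ) (hx : -(3 * s) ≤ x) (hxy : x ≤ y)
    (hy : y ≤ 3 * s) :
    (gaussianReal 0 (Real.toNNReal (s ^ 2))).real (Set.Ici y)
      + (Real.exp (-(9 / 2)) / 3) * ((y - x) / s)
      ≤ (gaussianReal 0 (Real.toNNReal (s ^ 2))).real (Set.Ici x) := by
  have hd : Set.Ico x y = Set.Ici x \ Set.Ici y := by ext; simp
  have := measureReal_sdiff (μ := gaussianReal 0 (Real.toNNReal (s ^ 2)))
    (Set.Ici_subset_Ici.2 hxy) (measurableSet_Ici (a := y))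
  rw [← hd, gauss_real 0 hs] at this
  suffices h : (Real.exp (-(9 / 2)) / 3) * ((y - x) / s)
      ≤ ∫ x in Set.Ico x y, gaussianPDFReal 0 (Real.toNNReal (s ^ 2)) x by linarith
  have hc : ∫ _z in Set.Ico x y, (Real.exp (-(9 / 2)) / 3 / s : ℝ)
      = (Real.exp (-(9 / 2)) / 3) * ((y - x) / s) := by
    rw [setIntegral_const, smul_eq_mul, measureReal_def, Real.volume_Ico,
      ENNReal.toReal_ofReal (by linarith)]
    ring
  rw [← hc]
  refine setIntegral_mono_on (integrableOn_const (by simp))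
    (integrable_gaussianPDFReal _ _).integrableOn measurableSet_Ico fun z hz => ?_
  rw [gpdf_eq 0 hs]
  have h1 : (3 : ℝ)⁻¹ ≤ (Real.sqrt (2 * Real.pi))⁻¹ :=
    inv_anti₀ (by linarith [one_le_sqrt_two_pi]) sqrt_two_pi_le
  have h2 : Real.exp (-(9 / 2)) ≤ Real.exp (-(z - 0) ^ 2 / (2 * s ^ 2)) := by
    rw [Real.exp_le_exp, sub_zero, neg_div, neg_le_neg_iff, div_le_iff₀ (by positivity)]
    have : z ^ 2 ≤ (3 * s) ^ 2 := sq_le_sq' (by linarith [hz.1]) (by linarith [hz.2])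
    linarith
  calc Real.exp (-(9 / 2)) / 3 / s = 3⁻¹ * s⁻¹ * Real.exp (-(9 / 2)) := by ring
    _ ≤ _ := by gcongr

/-- `psi a = E [exp (-a Z); Z ≥ 0]` -/
def psi (a : ℝ) : ℝ := ∫ z in Set.Ici (0 : ℝ), Real.exp (-(a * z)) * gaussianPDFReal 0 1 z

lemma psi_integrable {a : ℝ} (ha : 0 ≤ a) :
    IntegrableOn (fun z => Real.exp (-(a * z)) * gaussianPDFReal 0 1 z) (Set.Ici 0) := by
  refine (integrable_gaussianPDFReal 0 1).integrableOn.mono' ?_ ?_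
  · exact ((by fun_prop : Measurable fun z : ℝ => Real.exp (-(a * z))).mul
      (measurable_gaussianPDFReal 0 1)).aestronglyMeasurable
  · filter_upwards [ae_restrict_mem measurableSet_Ici] with z hz
    rw [norm_mul, Real.norm_eq_abs, Real.norm_eq_abs, abs_of_pos (Real.exp_pos _),
      abs_of_nonneg (gaussianPDFReal_nonneg _ _ _)]
    refine mul_le_of_le_one_left (gaussianPDFReal_nonneg _ _ _) ?_
    rw [Real.exp_le_one_iff]
    have : 0 ≤ a * z := mul_nonneg ha hz
    linarith

lemma psi_anti {a b : ℝ} (ha : 0 ≤ a) (hab : a ≤ b) : psi b ≤ psi a := by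
  refine setIntegral_mono_on (psi_integrable (ha.trans hab)) (psi_integrable ha)
    measurableSet_Ici fun z hz => ?_
  refine mul_le_mul_of_nonneg_right ?_ (gaussianPDFReal_nonneg _ _ _)
  rw [Real.exp_le_exp, neg_le_neg_iff]
  exact mul_le_mul_of_nonneg_right hab hz

lemma psi_lower {a : ℝ} (ha : 0 ≤ a) : Real.exp (-(3 / 2)) / 3 / (1 + a) ≤ psi a := by
  have hpos : 0 < 1 + a := by linarith
  have hc : ∫ _z in Set.Ico (0 : ℝ) (1 / (1 + a)), (Real.exp (-(3 / 2)) / 3 : ℝ)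
      = Real.exp (-(3 / 2)) / 3 / (1 + a) := by
    rw [setIntegral_const, smul_eq_mul, measureReal_def, Real.volume_Ico,
      ENNReal.toReal_ofReal (by rw [sub_zero]; positivity)]
    ring
  rw [← hc]
  calc _ ≤ ∫ z in Set.Ico (0 : ℝ) (1 / (1 + a)), Real.exp (-(a * z)) * gaussianPDFReal 0 1 z := by
        refine setIntegral_mono_on (integrableOn_const (by simp))
          ((psi_integrable ha).mono_set Set.Ico_subset_Ici_self) measurableSet_Ico fun z hz => ?_
        have hg := gpdf_eq 0 (one_pos : (0 : ℝ) < 1) z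
        rw [one_pow, Real.toNNReal_one] at hg
        rw [hg]
        have h1 : (3 : ℝ)⁻¹ ≤ (Real.sqrt (2 * Real.pi))⁻¹ :=
          inv_anti₀ (by linarith [one_le_sqrt_two_pi]) sqrt_two_pi_le
        have hz2 : z * (1 + a) ≤ 1 := by
          have := hz.2.le
          rwa [le_div_iff₀ hpos] at this
        have hz0 := hz.1
        have haz : 0 ≤ a * z := mul_nonneg ha hz0
        have hz1 : z ≤ 1 := by nlinarith
        have hsum : Real.exp (-(3 / 2)) ≤ Real.exp (-(a * z)) * Real.exp (-(z - 0) ^ 2 / (2 * 1 ^ 2)) := by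
          rw [← Real.exp_add, Real.exp_le_exp]
          nlinarith
        calc Real.exp (-(3 / 2)) / 3 = 3⁻¹ * Real.exp (-(3 / 2)) := by ring
          _ ≤ (Real.sqrt (2 * Real.pi))⁻¹ * (Real.exp (-(a * z)) * Real.exp (-(z - 0) ^ 2 / (2 * 1 ^ 2))) := by
              gcongr
          _ = _ := by
              simp
              ring
    _ ≤ psi a := by
        refine setIntegral_mono_set (psi_integrable ha) ?_ (Filter.Eventually.of_forall ?_)
        · refine Filter.Eventually.of_forall fun z => ?_
          exact mul_nonneg (Real.exp_pos _).le (gaussianPDFReal_nonneg _ _ _)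
        · exact Set.Ico_subset_Ici_self

lemma gauss_map (m : ℝ) {s : ℝ} (hs : 0 < s) :
    (gaussianReal 0 1).map (fun z => m + s * z) = gaussianReal m (Real.toNNReal (s ^ 2)) := by
  have h1 : (fun z : ℝ => m + s * z) = (fun x => m + x) ∘ (fun z => s * z) := rfl
  rw [h1, ← Measure.map_map (by fun_prop) (by fun_prop), gaussianReal_map_const_mul,
    gaussianReal_map_const_add]
  congr 1
  · ring
  · rw [mul_one]
    ext
    simp [Real.coe_toNNReal _ (sq_nonneg s)]

lemma gauss_int_psi (m h : ℝ) {s : ℝ} (hs : 0 < s) :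
    ∫ x in Set.Ici m, Real.exp (-(h * (x - m))) ∂(gaussianReal m (Real.toNNReal (s ^ 2)))
      = psi (h * s) := by
  rw [← gauss_map m hs, setIntegral_map measurableSet_Ici (by fun_prop) (by fun_prop)]
  have : (fun z => m + s * z) ⁻¹' Set.Ici m = Set.Ici 0 := by
    ext z
    simp only [Set.mem_preimage, Set.mem_Ici]
    constructor
    · intro hz
      have : 0 ≤ s * z := by linarith
      exact nonneg_of_mul_nonneg_right this hs
    · intro hz
      have : 0 ≤ s * z := mul_nonneg hs.le hz
      linarith
  rw [this, gaussianReal_of_var_ne_zero _ one_ne_zero]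
  unfold gaussianPDF
  rw [setIntegral_withDensity_eq_setIntegral_toReal_smul]
  · unfold psi
    congr 1
    ext z
    rw [ENNReal.toReal_ofReal (gaussianPDFReal_nonneg _ _ _), smul_eq_mul, mul_comm]
    congr 2
    ring
  · exact (measurable_gaussianPDFReal 0 1).ennreal_ofReal
  · exact Filter.Eventually.of_forall fun z => ENNReal.ofReal_lt_top
  · exact measurableSet_Ici

lemma gauss_tail {s : ℝ} (hs : 0 < s) (θ : ℝ) :
    (gaussianReal 0 (Real.toNNReal (s ^ 2))).real (Set.Ici (s ^ 2 * θ))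
      = Real.exp (-(s ^ 2 * θ ^ 2 / 2)) * psi (θ * s) := by
  rw [← gauss_map 0 hs, map_measureReal_apply (by fun_prop) measurableSet_Ici]
  have : (fun z => 0 + s * z) ⁻¹' Set.Ici (s ^ 2 * θ) = Set.Ici (s * θ) := by
    ext z
    simp only [Set.mem_preimage, Set.mem_Ici, zero_add]
    rw [sq, mul_assoc, mul_le_mul_iff_right₀ hs]
  rw [this]
  have hg := gauss_real 0 (one_pos : (0 : ℝ) < 1) (Set.Ici (s * θ))
  rw [one_pow, Real.toNNReal_one] at hg
  rw [hg]
  unfold psi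
  rw [← integral_const_mul, ← integral_indicator measurableSet_Ici,
    ← integral_indicator measurableSet_Ici,
    ← integral_add_right_eq_self ((Set.Ici (s * θ)).indicator (gaussianPDFReal 0 1)) (s * θ)]
  congr 1
  ext z
  simp only [Set.indicator, Set.mem_Ici, le_add_iff_nonneg_left]
  split_ifs with hz
  · simp only [gaussianPDFReal_def]
    rw [mul_left_comm (Real.exp (-(θ * s * z))), mul_left_comm (Real.exp (-(s ^ 2 * θ ^ 2 / 2))),
      ← Real.exp_add, ← Real.exp_add]
    congr 2
    simp
    ring
  · rfl

lemma exp_compare (μ ν : Measure ℝ) [IsProbabilityMeasure μ] [IsProbabilityMeasure ν] {Δ h : ℝ}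
    (m : ℝ) (hh : 0 < h)
    (hΔ : ∀ x, |μ.real (Set.Iio x) - ν.real (Set.Iio x)| ≤ Δ) :
    |(∫ x in Set.Ici m, Real.exp (-(h * (x - m))) ∂μ)
      - ∫ x in Set.Ici m, Real.exp (-(h * (x - m))) ∂ν| ≤ 2 * Δ := by
  set f : ℝ → ℝ := (Set.Ici m).indicator (fun x => Real.exp (-(h * (x - m)))) with hf
  have hfm : Measurable f := (by fun_prop : Measurable fun x : ℝ => Real.exp (-(h * (x - m)))).indicator
    measurableSet_Ici
  have hf0 : ∀ x, 0 ≤ f x := fun x => Set.indicator_nonneg (fun _ _ => (Real.exp_pos _).le) x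
  have hf1 : ∀ x, f x ≤ 1 := by
    intro x
    simp only [hf, Set.indicator]
    split_ifs with hx
    · rw [Real.exp_le_one_iff]
      have : 0 ≤ h * (x - m) := mul_nonneg hh.le (sub_nonneg.2 hx)
      linarith
    · exact zero_le_one
  have lay : ∀ (ρ : Measure ℝ) [IsProbabilityMeasure ρ],
      ∫ x in Set.Ici m, Real.exp (-(h * (x - m))) ∂ρ
        = ∫ t in Set.Ioo (0 : ℝ) 1, (ρ.real (Set.Iio (m - Real.log t / h)) - ρ.real (Set.Iio m)) := by
    intro ρ _
    have hi : Integrable f ρ := by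
      refine (integrable_const (1 : ℝ)).mono' hfm.aestronglyMeasurable
        (Filter.Eventually.of_forall fun x => ?_)
      rw [Real.norm_eq_abs, abs_of_nonneg (hf0 x)]
      exact hf1 x
    rw [← integral_indicator measurableSet_Ici, ← hf,
      hi.integral_eq_integral_meas_lt (Filter.Eventually.of_forall hf0),
      setIntegral_eq_of_subset_of_forall_sdiff_eq_zero measurableSet_Ioi
        (Set.Ioo_subset_Ioi_self : Set.Ioo (0 : ℝ) 1 ⊆ Set.Ioi 0)]
    · refine setIntegral_congr_fun measurableSet_Ioo fun t ht => ?_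
      have hset : {a | t < f a} = Set.Iio (m - Real.log t / h) \ Set.Iio m := by
        ext x
        simp only [hf, Set.indicator, Set.mem_Ici, Set.mem_setOf_eq, Set.mem_sdiff, Set.mem_Iio, not_lt]
        split_ifs with hx
        · simp only [hx, and_true]
          rw [← Real.log_lt_iff_lt_exp ht.1, lt_sub_comm, div_lt_iff₀ hh]
          constructor <;> intro h' <;> linarith
        · simp only [hx, and_false, iff_false, not_lt]
          exact ht.1.le
      simp only [hset]
      rw [measureReal_sdiff _ measurableSet_Iio]
      refine Set.Iio_subset_Iio ?_
      have : Real.log t / h ≤ 0 := div_nonpos_of_nonpos_of_nonneg (Real.log_nonpos ht.1.le ht.2.le) hh.le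
      linarith
    · intro t ht
      have ht0 : 0 < t := ht.1
      have ht1 : 1 ≤ t := by
        by_contra hlt
        exact ht.2 ⟨ht0, not_le.1 hlt⟩
      have : {a | t < f a} = ∅ := by
        ext x
        simp only [Set.mem_setOf_eq, Set.mem_empty_iff_false, iff_false, not_lt]
        exact (hf1 x).trans ht1
      rw [this]
      simp
  have hint : ∀ (ρ : Measure ℝ) [IsProbabilityMeasure ρ], IntegrableOn
      (fun t => ρ.real (Set.Iio (m - Real.log t / h)) - ρ.real (Set.Iio m)) (Set.Ioo (0 : ℝ) 1) := by
    intro ρ _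
    have hc : IntegrableOn (fun _ : ℝ => (1 : ℝ)) (Set.Ioo (0 : ℝ) 1) := integrableOn_const (by simp)
    refine hc.mono' ?_ (Filter.Eventually.of_forall fun t => ?_)
    · exact (((mono_Iio ρ).measurable.comp
        (by fun_prop : Measurable fun t : ℝ => m - Real.log t / h)).sub_const _).aestronglyMeasurable
    · have h1 : ρ.real (Set.Iio (m - Real.log t / h)) ≤ 1 := measureReal_le_one
      have h2 : ρ.real (Set.Iio m) ≤ 1 := measureReal_le_one
      have h3 : 0 ≤ ρ.real (Set.Iio (m - Real.log t / h)) := measureReal_nonneg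
      have h4 : 0 ≤ ρ.real (Set.Iio m) := measureReal_nonneg
      exact abs_le.2 ⟨by linarith, by linarith⟩
  rw [lay μ, lay ν, ← integral_sub (hint μ) (hint ν), ← Real.norm_eq_abs]
  have hfin : ‖∫ t in Set.Ioo (0 : ℝ) 1,
      ((μ.real (Set.Iio (m - Real.log t / h)) - μ.real (Set.Iio m))
        - (ν.real (Set.Iio (m - Real.log t / h)) - ν.real (Set.Iio m)))‖
      ≤ 2 * Δ * volume.real (Set.Ioo (0 : ℝ) 1) := by
    refine norm_setIntegral_le_of_norm_le_const (by simp) fun t _ => ?_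
    have h1 := abs_le.1 (hΔ (m - Real.log t / h))
    have h2 := abs_le.1 (hΔ m)
    exact abs_le.2 ⟨by linarith [h1.1, h2.2], by linarith [h1.2, h2.1]⟩
  simpa [measureReal_def] using hfin

lemma tilt_tail (F : Measure ℝ) [IsProbabilityMeasure F] (h m L : ℝ)
    (hL : ∫ x : ℝ, Real.exp (h * x) ∂F = Real.exp L) :
    F.real (Set.Ici m) = Real.exp (L - h * m) *
      ∫ x in Set.Ici m, Real.exp (-(h * (x - m))) ∂(F.tilted (fun x => h * x)) := by
  rw [setIntegral_tilted, hL, ← integral_const_mul]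
  have : ∀ x : ℝ, Real.exp (L - h * m) *
      ((Real.exp (h * x) / Real.exp L) • Real.exp (-(h * (x - m)))) = 1 := by
    intro x
    rw [smul_eq_mul, ← Real.exp_sub, ← Real.exp_add, ← Real.exp_add, Real.exp_eq_one_iff]
    ring
  simp_rw [this]
  simp


set_option maxHeartbeats 1000000 in
lemma tilt_bounds : ∃ D : ℝ, 1 ≤ D ∧ ∀ (F : Measure ℝ) (f f1 f2 f3 : ℂ → ℂ) (σ : ℝ),
    IsProbabilityMeasure F → Nice (1 / 16) F f f1 f2 f3 → ∫ x, x ∂F = 0 →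
    variance id F = σ ^ 2 → 2 * D ≤ σ → ∀ h : ℝ, 1 / σ ≤ h → h ≤ 1 / (4 * D) →
    ∃ m, |m - σ ^ 2 * h| ≤ σ ^ 2 * h ^ 2 / 16 ∧
      (gaussianReal 0 (Real.toNNReal (σ ^ 2))).real
        (Set.Ici (σ ^ 2 * (h + D * (h ^ 2 + 1 / σ ^ 2)))) ≤ F.real (Set.Ici m) ∧
      F.real (Set.Ici m) ≤ (gaussianReal 0 (Real.toNNReal (σ ^ 2))).real
        (Set.Ici (σ ^ 2 * (h - D * (h ^ 2 + 1 / σ ^ 2)))) := by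
  obtain ⟨C₀, hC₀, BE⟩ := berry_esseen
  set κ : ℝ := Real.exp (-(3 / 2)) / 3 with hκ
  have hκ0 : 0 < κ := by positivity
  set C₂ : ℝ := 9 * C₀ / κ with hC₂
  have hC₂0 : 0 < C₂ := by positivity
  refine ⟨4 * C₂ + 1, by linarith, ?_⟩
  intro F f f1 f2 f3 σ _ hN hm0 hvar hσD h hh1 hh2
  set D : ℝ := 4 * C₂ + 1 with hD
  have hD1 : 1 ≤ D := by linarith
  have hσ : 0 < σ := by linarith
  have hh0 : 0 < h := lt_of_lt_of_le (by positivity) hh1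
  have hσh : 1 ≤ h * σ := by rwa [div_le_iff₀ hσ] at hh1
  have hDh : D * h ≤ 1 / 4 := by
    rw [le_div_iff₀ (by positivity)] at hh2; linarith
  have hh3 : h ≤ 1 := by nlinarith
  obtain ⟨m, s, L, hs, hs2, hm, hL, hint, hLe, hchar⟩ :=
    Nice.tilt hN hm0 hvar (by positivity) (h := h) (by rw [abs_of_pos hh0]; exact hh3)
  rw [abs_of_pos hh0] at hs2 hL
  refine ⟨m, hm, ?_⟩
  have : IsProbabilityMeasure (F.tilted (fun x => h * x)) := isProbabilityMeasure_tilted hint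
  have hs2' := abs_le.1 hs2
  have hslo : σ * (1 - h / 16) ≤ s := by
    refine le_of_sq_le_sq ?_ hs.le
    nlinarith [hs2'.1, mul_pos (mul_pos hσ hσ) hh0, mul_nonneg (mul_pos (mul_pos hσ hσ) hh0).le (sub_nonneg.2 hh3)]
  have hshi : s ≤ σ * (1 + h / 16) := by
    refine le_of_sq_le_sq ?_ (by positivity)
    nlinarith [hs2'.2, mul_pos (mul_pos hσ hσ) hh0, mul_pos (mul_pos (mul_pos hσ hσ) hh0) hh0]
  have hb := BE (F.tilted (fun x => h * x)) (gaussianReal m (Real.toNNReal (s ^ 2))) s hs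
    (fun x y hxy => gauss_lip m hs x y hxy) (by
      intro t ht0 ht1
      have := hchar t ht0 ht1
      rw [charFun_gaussianReal]
      convert this using 4
      rw [Real.coe_toNNReal _ (sq_nonneg s)]
      push_cast
      ring)
  have hcmp := exp_compare _ _ m hh0 hb
  rw [gauss_int_psi m h hs] at hcmp
  have htail := tilt_tail F h m L hLe
  set I := ∫ x in Set.Ici m, Real.exp (-(h * (x - m))) ∂(F.tilted (fun x => h * x)) with hI
  have hcmp' := abs_le.1 hcmp
  have hm' := abs_le.1 hm
  have hL' := abs_le.1 hL
  have herr : 2 * (C₀ / s) ≤ 3 * C₀ / σ := by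
    rw [← mul_div_assoc, div_le_div_iff₀ hs hσ]
    nlinarith [mul_nonneg (mul_pos hC₀ hσ).le (sub_nonneg.2 hh3)]
  have herr2 : ∀ a, 0 ≤ a → a ≤ 2 * (h * σ) → 3 * C₀ / σ ≤ C₂ * h * psi a := by
    intro a ha0 ha
    have h1 := psi_lower ha0
    have h2 : κ / (3 * (h * σ)) ≤ psi a := by
      refine le_trans ?_ h1
      rw [← hκ]
      exact div_le_div_of_nonneg_left hκ0.le (by linarith) (by linarith)
    calc 3 * C₀ / σ = C₂ * h * (κ / (3 * (h * σ))) := by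
          rw [hC₂]; field_simp; ring
      _ ≤ _ := by gcongr
  have hpsi0 : ∀ a, 0 ≤ a → 0 < psi a := fun a ha =>
    lt_of_lt_of_le (by positivity) (psi_lower ha)
  have hdV : D * (1 / σ ^ 2) ≤ h / 2 := by
    have : D * (1 / σ ^ 2) = (2 * D / σ) * (1 / σ) / 2 := by field_simp
    rw [this]
    have h2 : 2 * D / σ ≤ 1 := by rwa [div_le_one hσ]
    have : (2 * D / σ) * (1 / σ) ≤ 1 * (1 / σ) := by gcongr
    linarith
  have hVr : σ ^ 2 * (1 / σ ^ 2) = 1 := by field_simp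
  have hr0 : 0 < 1 / σ ^ 2 := by positivity
  set r := 1 / σ ^ 2 with hr
  set V := σ ^ 2 with hV
  have hV0 : 0 < V := by positivity
  have hhm1 : h * m - V * h ^ 2 ≤ V * h ^ 3 / 16 := by
    have h1 := mul_le_mul_of_nonneg_left hm'.2 hh0.le
    have h2 : h * (V * h ^ 2 / 16) = V * h ^ 3 / 16 := by ring
    have h3 : h * (-(V * h ^ 2 / 16)) = -(V * h ^ 3 / 16) := by ring
    have h4 : h * (m - V * h) = h * m - V * h ^ 2 := by ring
    linarith
  have hhm2 : -(V * h ^ 3 / 16) ≤ h * m - V * h ^ 2 := by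
    have h1 := mul_le_mul_of_nonneg_left hm'.1 hh0.le
    have h2 : h * (V * h ^ 2 / 16) = V * h ^ 3 / 16 := by ring
    have h3 : h * (-(V * h ^ 2 / 16)) = -(V * h ^ 3 / 16) := by ring
    have h4 : h * (m - V * h) = h * m - V * h ^ 2 := by ring
    linarith
  have hVh3 : 0 < V * h ^ 3 := by positivity
  have hσσ : σ * h ≤ 2 * (h * σ) := by nlinarith
  constructor
  ·
    have hθ0 : 0 ≤ h + D * (h ^ 2 + r) := by positivity
    rw [hV, gauss_tail hσ, ← hV, htail]
    have h1 : psi ((h + D * (h ^ 2 + r)) * σ) ≤ psi (h * s) := by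
      refine psi_anti (by positivity) ?_
      have : h * s ≤ h * (σ * (1 + h / 16)) := by gcongr
      have q1 : 0 < σ * h * h := by positivity
      have q2 : 0 < D * r * σ := by positivity
      have q3 : 1 * (σ * h * h) ≤ D * (σ * h * h) := by gcongr
      have q4 : (h + D * (h ^ 2 + r)) * σ = h * σ + D * (σ * h * h) + D * r * σ := by ring
      have q5 : h * (σ * (1 + h / 16)) = h * σ + (σ * h * h) / 16 := by ring
      linarith
    have hhs : h * s ≤ 2 * (h * σ) := by
      have : h * s ≤ h * (σ * (1 + h / 16)) := by gcongr
      nlinarith [mul_nonneg (mul_pos hσ hh0).le (sub_nonneg.2 hh3)]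
    have h2 := herr2 (h * s) (by positivity) hhs
    have hx : C₂ * h ≤ 1 / 2 := by nlinarith
    have hx0 : 0 < C₂ * h := by positivity
    have h3 : Real.exp (-(2 * (C₂ * h))) ≤ 1 - C₂ * h := by
      rw [Real.exp_neg, inv_le_iff_one_le_mul₀ (Real.exp_pos _)]
      have := Real.add_one_le_exp (2 * (C₂ * h))
      nlinarith
    have hp := hpsi0 (h * s) (by positivity)
    have h4 : psi (h * s) * Real.exp (-(2 * (C₂ * h))) ≤ I := by
      have := mul_le_mul_of_nonneg_left h3 hp.le
      have q : psi (h * s) * (1 - C₂ * h) = psi (h * s) - C₂ * h * psi (h * s) := by ring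
      linarith [hcmp'.1]
    calc Real.exp (-(V * (h + D * (h ^ 2 + r)) ^ 2 / 2)) * psi ((h + D * (h ^ 2 + r)) * σ)
        ≤ Real.exp (-(V * (h + D * (h ^ 2 + r)) ^ 2 / 2)) * psi (h * s) := by gcongr
      _ ≤ Real.exp (L - h * m - 2 * (C₂ * h)) * psi (h * s) := by
          refine mul_le_mul_of_nonneg_right (Real.exp_le_exp.2 ?_) hp.le
          have e1 : V * (h + D * (h ^ 2 + r)) ^ 2 / 2
              = V * h ^ 2 / 2 + D * (V * h ^ 3 + (V * r) * h) + V * (D * (h ^ 2 + r)) ^ 2 / 2 := by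
            ring
          have e2 : 0 ≤ V * (D * (h ^ 2 + r)) ^ 2 / 2 := by positivity
          have e3 : V * h ^ 3 + 2 * C₂ * h ≤ D * (V * h ^ 3 + (V * r) * h) := by
            rw [hVr]
            have : 1 * (V * h ^ 3) ≤ D * (V * h ^ 3) := by gcongr
            have : 2 * C₂ * h ≤ D * h := by gcongr; linarith
            linarith
          linarith [hL'.1]
      _ = Real.exp (L - h * m) * (psi (h * s) * Real.exp (-(2 * (C₂ * h)))) := by
          rw [sub_eq_add_neg _ (2 * (C₂ * h)), Real.exp_add]; ring
      _ ≤ _ := by gcongr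
  · have hθ0 : 0 ≤ h - D * (h ^ 2 + r) := by nlinarith
    rw [hV, gauss_tail hσ, ← hV, htail]
    set θ := h - D * (h ^ 2 + r) with hθ
    have hθh : θ ≤ h := by
      have : 0 ≤ D * (h ^ 2 + r) := by positivity
      linarith
    have h1 : psi (h * s) ≤ psi (θ * σ) := by
      refine psi_anti (by positivity) ?_
      have : h * (σ * (1 - h / 16)) ≤ h * s := by gcongr
      have q1 : 0 < σ * h * h := by positivity
      have q2 : 0 < D * r * σ := by positivity
      have q3 : 1 * (σ * h * h) ≤ D * (σ * h * h) := by gcongr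
      have q4 : θ * σ = h * σ - D * (σ * h * h) - D * r * σ := by rw [hθ]; ring
      have q5 : h * (σ * (1 - h / 16)) = h * σ - (σ * h * h) / 16 := by ring
      linarith
    have hθσ : θ * σ ≤ 2 * (h * σ) := by
      have : θ * σ ≤ h * σ := by gcongr
      linarith
    have h2 := herr2 (θ * σ) (by positivity) hθσ
    have hp := hpsi0 (θ * σ) (by positivity)
    have h4 : I ≤ psi (θ * σ) * Real.exp (C₂ * h) := by
      have := mul_le_mul_of_nonneg_left (Real.add_one_le_exp (C₂ * h)) hp.le
      have q : psi (θ * σ) * (C₂ * h + 1) = C₂ * h * psi (θ * σ) + psi (θ * σ) := by ring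
      linarith [hcmp'.2]
    calc Real.exp (L - h * m) * I
        ≤ Real.exp (L - h * m) * (psi (θ * σ) * Real.exp (C₂ * h)) := by gcongr
      _ = Real.exp (L - h * m + C₂ * h) * psi (θ * σ) := by rw [Real.exp_add]; ring
      _ ≤ _ := by
          refine mul_le_mul_of_nonneg_right (Real.exp_le_exp.2 ?_) hp.le
          have e1 : V * h ^ 2 / 2 - V * θ ^ 2 / 2
              = D * (V * h ^ 3 + (V * r) * h) / 2 + V * (h - θ) * θ / 2 := by
            rw [hθ]; ring
          have e2 : 0 ≤ V * (h - θ) * θ / 2 := by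
            have := sub_nonneg.2 hθh
            positivity
          have e3 : V * h ^ 3 + 2 * C₂ * h ≤ D * (V * h ^ 3 + (V * r) * h) := by
            rw [hVr]
            have : 1 * (V * h ^ 3) ≤ D * (V * h ^ 3) := by gcongr
            have : 2 * C₂ * h ≤ D * h := by gcongr; linarith
            linarith
          linarith [hL'.2]

lemma base_bound : ∃ C₀ : ℝ, 0 < C₀ ∧ ∀ (F : Measure ℝ) (f f1 f2 f3 : ℂ → ℂ) (σ : ℝ),
    IsProbabilityMeasure F → Nice (1 / 16) F f f1 f2 f3 → ∫ x, x ∂F = 0 →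
    variance id F = σ ^ 2 → 0 < σ → ∀ x,
      |F.real (Set.Ici x) - (gaussianReal 0 (Real.toNNReal (σ ^ 2))).real (Set.Ici x)| ≤ C₀ / σ := by
  obtain ⟨C₀, hC₀, BE⟩ := berry_esseen
  refine ⟨C₀, hC₀, ?_⟩
  intro F f f1 f2 f3 σ _ hN hm0 hvar hσ x
  obtain ⟨m, s, L, hs, hs2, hm, hL, hint, hLe, hchar⟩ :=
    Nice.tilt hN hm0 hvar (by positivity) (h := 0) (by simp)
  have hF : F.tilted (fun x => (0 : ℝ) * x) = F := by simp
  rw [hF] at hchar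
  have hm' : m = 0 := by simpa using hm
  have hs' : s ^ 2 = σ ^ 2 := by
    have : s ^ 2 - σ ^ 2 = 0 := by simpa using hs2
    linarith
  have hsσ : s = σ := by
    rwa [sq_eq_sq₀ hs.le hσ.le] at hs'
  subst hsσ
  subst hm'
  have hb := BE F (gaussianReal 0 (Real.toNNReal (s ^ 2))) s hs
    (fun x y hxy => gauss_lip 0 hs x y hxy) (by
      intro t ht0 ht1
      have := hchar t ht0 ht1
      rw [charFun_gaussianReal]
      convert this using 4
      rw [Real.coe_toNNReal _ (sq_nonneg s)]
      push_cast
      ring) x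
  have hc : ∀ (μ : Measure ℝ) [IsProbabilityMeasure μ], μ.real (Set.Ici x) = 1 - μ.real (Set.Iio x) := by
    intro μ _
    rw [← Set.compl_Iio, probReal_compl_eq_one_sub measurableSet_Iio]
  rw [hc F, hc (gaussianReal _ _), abs_sub_comm]
  convert hb using 2
  ring

lemma anti_Ici (μ : Measure ℝ) [IsProbabilityMeasure μ] {x y : ℝ} (h : x ≤ y) :
    μ.real (Set.Ici y) ≤ μ.real (Set.Ici x) :=
  measureReal_mono (Set.Ici_subset_Ici.2 h)

set_option maxHeartbeats 1000000 in
lemma core_bound : ∃ C c : ℝ, 1 ≤ C ∧ 0 < c ∧ ∀ (F : Measure ℝ) (f f1 f2 f3 : ℂ → ℂ) (σ : ℝ),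
    IsProbabilityMeasure F → Nice (1 / 16) F f f1 f2 f3 → ∫ x, x ∂F = 0 →
    variance id F = σ ^ 2 → C ≤ σ → ∀ w : ℝ, 0 ≤ w → w ≤ c * σ ^ 2 →
      F.real (Set.Ici (w + C * (1 + w ^ 2 / σ ^ 2)))
        ≤ (gaussianReal 0 (Real.toNNReal (σ ^ 2))).real (Set.Ici (w + 1)) ∧
      (gaussianReal 0 (Real.toNNReal (σ ^ 2))).real (Set.Ici (w - 1))
        ≤ F.real (Set.Ici (w - C * (1 + w ^ 2 / σ ^ 2))) := by
  obtain ⟨C₀, hC₀, base⟩ := base_bound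
  obtain ⟨D, hD, tb⟩ := tilt_bounds
  set κ : ℝ := Real.exp (-(9 / 2)) / 3 with hκ
  have hκ0 : 0 < κ := by positivity
  have hq : 0 < C₀ / κ := by positivity
  refine ⟨8 * D + 1 + C₀ / κ, 1 / (10 * D), by linarith, by positivity, ?_⟩
  intro F f f1 f2 f3 σ hF hN hm0 hvar hσC w hw0 hwc
  set C := 8 * D + 1 + C₀ / κ with hC
  have hC8 : 8 * D ≤ C := by linarith
  have hCq : C₀ ≤ κ * (C - 1) := by
    have : κ * (C₀ / κ) = C₀ := by field_simp
    have : κ * (C - 1) = 8 * D * κ + κ * (C₀ / κ) := by rw [hC]; ring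
    have : 0 < 8 * D * κ := by positivity
    linarith
  clear_value C κ
  have hσ : 0 < σ := by linarith
  have hV0 : 0 < σ ^ 2 := by positivity
  set ε := w ^ 2 / σ ^ 2 with hε
  have hε0 : 0 ≤ ε := by positivity
  have hεV : ε * σ ^ 2 = w ^ 2 := by rw [hε]; field_simp
  have hwD : w * (10 * D) ≤ σ ^ 2 := by
    rw [one_div, inv_mul_eq_div, le_div_iff₀ (by positivity)] at hwc
    exact hwc
  clear_value ε
  have hCε : 0 ≤ C * ε := mul_nonneg (by linarith) hε0
  have hDε : 0 ≤ D * ε := mul_nonneg (by linarith) hε0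
  have hD8ε : 8 * D * ε ≤ C * ε := mul_le_mul_of_nonneg_right hC8 hε0
  rcases le_total w (2 * σ) with hA | hB
  · have hb := fun x => abs_le.1 (base F f f1 f2 f3 σ hF hN hm0 hvar hσ x)
    have hk : C₀ / σ ≤ κ * ((C - 1) / σ) := by
      rw [← mul_div_assoc]
      gcongr
    constructor
    · have h1 := gauss_lower hσ (w + 1) (w + C) (by linarith) (by linarith) (by linarith)
      rw [← hκ] at h1
      have h2 := anti_Ici F (show w + C ≤ w + C * (1 + ε) by linarith)
      have h3 : w + C - (w + 1) = C - 1 := by ring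
      rw [h3] at h1
      linarith [(hb (w + C)).2]
    · have h1 := gauss_lower hσ (w - C) (w - 1) (by linarith) (by linarith) (by linarith)
      rw [← hκ] at h1
      have h2 := anti_Ici F (show w - C * (1 + ε) ≤ w - C by linarith)
      have h3 : w - 1 - (w - C) = C - 1 := by ring
      rw [h3] at h1
      linarith [(hb (w - C)).1]
  · have hw : 0 < w := by linarith
    have hε4 : 4 ≤ ε := by
      have h1 : (2 * σ) ^ 2 ≤ w ^ 2 := by gcongr
      by_contra hlt
      have : ε * σ ^ 2 < 4 * σ ^ 2 := mul_lt_mul_of_pos_right (not_le.1 hlt) hV0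
      linarith [hεV]
    have hεw : 10 * D * ε ≤ w := by
      have h1 : (10 * D * ε) * σ ^ 2 ≤ w * σ ^ 2 := by
        calc (10 * D * ε) * σ ^ 2 = (w * (10 * D)) * w := by rw [mul_assoc, hεV]; ring
          _ ≤ σ ^ 2 * w := by gcongr
          _ = w * σ ^ 2 := by ring
      exact le_of_mul_le_mul_right h1 hV0
    set δ := 4 * D * (1 + ε) with hδ
    have hδ0 : 0 < δ := by positivity
    have hδw : δ ≤ w / 2 := by
      have : D * 4 ≤ D * ε := by gcongr
      have e : δ = 4 * D + 4 * (D * ε) := by rw [hδ]; ring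
      linarith
    have hDε' : ε ≤ D * ε := le_mul_of_one_le_left hε0 hD
    have hδe : δ = 4 * D + 4 * (D * ε) := by rw [hδ]; ring
    clear_value δ
    have hCδ : 2 * δ ≤ C * (1 + ε) := by linarith
    have hσD : 2 * D ≤ σ := by linarith
    constructor
    · obtain ⟨m, hm, -, hup⟩ := tb F f f1 f2 f3 σ hF hN hm0 hvar hσD ((w + δ) / σ ^ 2)
        (by rw [div_le_div_iff₀ hσ hV0]; nlinarith)
        (by rw [div_le_div_iff₀ hV0 (by positivity)]; nlinarith)
      have e1 : σ ^ 2 * ((w + δ) / σ ^ 2) = w + δ := by field_simp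
      have e2 : σ ^ 2 * ((w + δ) / σ ^ 2) ^ 2 ≤ 9 / 4 * ε := by
        have : σ ^ 2 * ((w + δ) / σ ^ 2) ^ 2 = (w + δ) ^ 2 / σ ^ 2 := by field_simp
        rw [this, div_le_iff₀ hV0, mul_assoc, hεV]
        have : (w + δ) ^ 2 ≤ (3 / 2 * w) ^ 2 := by
          gcongr
          linarith
        linarith
      rw [e1] at hm
      have hm2 := (abs_le.1 hm).2
      have e3 : σ ^ 2 * ((w + δ) / σ ^ 2 - D * (((w + δ) / σ ^ 2) ^ 2 + 1 / σ ^ 2))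
          = w + δ - D * (σ ^ 2 * ((w + δ) / σ ^ 2) ^ 2) - D := by
        field_simp
        ring
      rw [e3] at hup
      have e4 : D * (σ ^ 2 * ((w + δ) / σ ^ 2) ^ 2) ≤ D * (9 / 4 * ε) := by gcongr
      calc _ ≤ F.real (Set.Ici m) := anti_Ici F (by linarith)
        _ ≤ _ := hup
        _ ≤ _ := anti_Ici _ (by linarith)
    · obtain ⟨m, hm, hlo, -⟩ := tb F f f1 f2 f3 σ hF hN hm0 hvar hσD ((w - δ) / σ ^ 2)
        (by rw [div_le_div_iff₀ hσ hV0]; nlinarith)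
        (by rw [div_le_div_iff₀ hV0 (by positivity)]; nlinarith)
      have e1 : σ ^ 2 * ((w - δ) / σ ^ 2) = w - δ := by field_simp
      have e2 : σ ^ 2 * ((w - δ) / σ ^ 2) ^ 2 ≤ ε := by
        have : σ ^ 2 * ((w - δ) / σ ^ 2) ^ 2 = (w - δ) ^ 2 / σ ^ 2 := by field_simp
        rw [this, div_le_iff₀ hV0, hεV]
        gcongr
        · linarith
        · linarith
      rw [e1] at hm
      have hm2 := (abs_le.1 hm).1
      have e3 : σ ^ 2 * ((w - δ) / σ ^ 2 + D * (((w - δ) / σ ^ 2) ^ 2 + 1 / σ ^ 2))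
          = w - δ + D * (σ ^ 2 * ((w - δ) / σ ^ 2) ^ 2) + D := by
        field_simp
        ring
      rw [e3] at hlo
      have e4 : D * (σ ^ 2 * ((w - δ) / σ ^ 2) ^ 2) ≤ D * ε := by gcongr
      calc _ ≤ _ := anti_Ici _ (by linarith)
        _ ≤ _ := hlo
        _ ≤ _ := anti_Ici F (by linarith)

lemma quantile_exists (μ : Measure ℝ) [IsProbabilityMeasure μ] :
    ∃ X : ℝ → ℝ, AEMeasurable X (volume.restrict (Set.Ioo (0 : ℝ) 1)) ∧
      (volume.restrict (Set.Ioo (0 : ℝ) 1)).map X = μ ∧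
      ∀ u ∈ Set.Ioo (0 : ℝ) 1, ∀ x, X u ≤ x ↔ u ≤ μ.real (Set.Iic x) := by
  have gal : ∀ u ∈ Set.Ioo (0 : ℝ) 1, ∀ x, sInf {x | u ≤ cdf μ x} ≤ x ↔ u ≤ cdf μ x := by
    intro u hu x
    have hne : {x | u ≤ cdf μ x}.Nonempty := by
      obtain ⟨x, hx⟩ := ((tendsto_cdf_atTop μ).eventually (lt_mem_nhds hu.2)).exists
      exact ⟨x, le_of_lt hx⟩
    have hbd : BddBelow {x | u ≤ cdf μ x} := by
      obtain ⟨x, hx⟩ := ((tendsto_cdf_atBot μ).eventually (gt_mem_nhds hu.1)).exists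
      refine ⟨x, fun y hy => ?_⟩
      by_contra hlt
      have : cdf μ y ≤ cdf μ x := monotone_cdf μ (not_le.1 hlt).le
      have hy' : u ≤ cdf μ y := hy
      linarith
    constructor
    · intro hx
      have key : ∀ y, x < y → u ≤ cdf μ y := by
        intro y hy
        obtain ⟨z, hz, hzy⟩ := (csInf_lt_iff hbd hne).1 (lt_of_le_of_lt hx hy)
        exact le_trans hz (monotone_cdf μ hzy.le)
      have hc : ContinuousWithinAt (cdf μ) (Set.Ioi x) x :=
        ((cdf μ).right_continuous x).mono Set.Ioi_subset_Ici_self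
      refine ge_of_tendsto hc ?_
      filter_upwards [self_mem_nhdsWithin] with y hy using key y hy
    · intro hx
      exact csInf_le hbd hx
  refine ⟨fun u => sInf {x | u ≤ cdf μ x}, ?_, ?_, ?_⟩
  · refine aemeasurable_restrict_of_monotoneOn measurableSet_Ioo ?_
    intro u hu v hv huv
    exact (gal u hu _).2 (huv.trans ((gal v hv _).1 le_rfl))
  · have ham : AEMeasurable (fun u => sInf {x | u ≤ cdf μ x}) (volume.restrict (Set.Ioo (0 : ℝ) 1)) := by
      refine aemeasurable_restrict_of_monotoneOn measurableSet_Ioo ?_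
      intro u hu v hv huv
      exact (gal u hu _).2 (huv.trans ((gal v hv _).1 le_rfl))
    have hp : IsProbabilityMeasure (volume.restrict (Set.Ioo (0 : ℝ) 1)) := ⟨by simp⟩
    have := Measure.isProbabilityMeasure_map ham
    refine Measure.eq_of_cdf _ _ ?_
    ext x
    rw [cdf_eq_real, cdf_eq_real, measureReal_def, Measure.map_apply_of_aemeasurable ham measurableSet_Iic,
      Measure.restrict_apply' measurableSet_Ioo]
    have hc0 : 0 ≤ cdf μ x := cdf_nonneg μ x
    have hc1 : cdf μ x ≤ 1 := cdf_le_one μ x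
    have hset : (fun u => sInf {x | u ≤ cdf μ x}) ⁻¹' Set.Iic x ∩ Set.Ioo 0 1
        = Set.Iic (cdf μ x) ∩ Set.Ioo 0 1 := by
      ext u
      simp only [Set.mem_inter_iff, Set.mem_preimage, Set.mem_Iic]
      constructor
      · rintro ⟨h1, h2⟩
        exact ⟨(gal u h2 x).1 h1, h2⟩
      · rintro ⟨h1, h2⟩
        exact ⟨(gal u h2 x).2 h1, h2⟩
    have hae : (Set.Iic (cdf μ x) ∩ Set.Ioo 0 1 : Set ℝ) =ᵐ[volume] Set.Ioc 0 (cdf μ x) := by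
      have h1 : (Set.Ioo (0 : ℝ) 1) =ᵐ[volume] Set.Ioc 0 1 := Ioo_ae_eq_Ioc
      have h2 := (Filter.EventuallyEq.refl (ae volume) (Set.Iic (cdf μ x))).inter h1
      refine h2.trans ?_
      have : Set.Iic (cdf μ x) ∩ Set.Ioc 0 1 = Set.Ioc 0 (cdf μ x) := by
        ext u
        simp only [Set.mem_inter_iff, Set.mem_Iic, Set.mem_Ioc]
        constructor
        · rintro ⟨h1, h2, h3⟩; exact ⟨h2, h1⟩
        · rintro ⟨h1, h2⟩; exact ⟨h2, h1, h2.trans hc1⟩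
      rw [this]
      exact Filter.EventuallyEq.rfl
    rw [hset, measure_congr hae, Real.volume_Ioc, sub_zero, ENNReal.toReal_ofReal hc0, cdf_eq_real]
  · intro u hu x
    rw [gal u hu x, cdf_eq_real]

lemma map_mul_prob (F : Measure ℝ) [IsProbabilityMeasure F] (a : ℝ) :
    IsProbabilityMeasure (F.map (fun x => a * x)) :=
  Measure.isProbabilityMeasure_map (by fun_prop)

lemma map_mul_mean (F : Measure ℝ) (a : ℝ) (h : ∫ x, x ∂F = 0) :
    ∫ x, x ∂(F.map (fun x => a * x)) = 0 := by
  rw [integral_map (by fun_prop) (by fun_prop), integral_const_mul, h, mul_zero]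

lemma map_mul_var (F : Measure ℝ) (a : ℝ) :
    variance id (F.map (fun x => a * x)) = a ^ 2 * variance id F := by
  rw [variance_map aemeasurable_id (by fun_prop), ← variance_const_mul]
  rfl

lemma gauss_symm (v : NNReal) (x : ℝ) :
    (gaussianReal 0 v).real (Set.Ici x) = (gaussianReal 0 v).real (Set.Iic (-x)) := by
  have h := gaussianReal_map_neg (μ := 0) (v := v)
  rw [neg_zero] at h
  conv_lhs => rw [← h]
  rw [map_measureReal_apply (by fun_prop) measurableSet_Ici]
  congr 1
  ext y
  simp

lemma refl_Ici (F : Measure ℝ) (x : ℝ) :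
    (F.map (fun x => (-1 : ℝ) * x)).real (Set.Ici x) = F.real (Set.Iic (-x)) := by
  rw [map_measureReal_apply (by fun_prop) measurableSet_Ici]
  congr 1
  ext y
  simp

lemma refl_Ioi (F : Measure ℝ) (x : ℝ) :
    (F.map (fun x => (-1 : ℝ) * x)).real (Set.Ioi x) = F.real (Set.Iio (-x)) := by
  rw [map_measureReal_apply (by fun_prop) measurableSet_Ioi]
  congr 1
  ext y
  simp

lemma Ioi_eq (F : Measure ℝ) [IsProbabilityMeasure F] (x : ℝ) :
    F.real (Set.Ioi x) = 1 - F.real (Set.Iic x) := by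
  rw [← Set.compl_Iic, probReal_compl_eq_one_sub measurableSet_Iic]

lemma Ici_eq (F : Measure ℝ) [IsProbabilityMeasure F] (x : ℝ) :
    F.real (Set.Ici x) = 1 - F.real (Set.Iio x) := by
  rw [← Set.compl_Iio, probReal_compl_eq_one_sub measurableSet_Iio]

lemma Nice.neg {F : Measure ℝ} {f f1 f2 f3 : ℂ → ℂ} (h : Nice (1 / 16) F f f1 f2 f3) :
    ∃ g g1 g2 g3, Nice (1 / 16) (F.map (fun x => (-1 : ℝ) * x)) g g1 g2 g3 := by
  have := h.scale (-1) (by norm_num)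
  rw [abs_neg, abs_one, one_mul] at this
  exact ⟨_, _, _, _, this⟩

lemma two_sided : ∃ C c : ℝ, 1 ≤ C ∧ 0 < c ∧ ∀ (F : Measure ℝ) (f f1 f2 f3 : ℂ → ℂ) (σ : ℝ),
    IsProbabilityMeasure F → Nice (1 / 16) F f f1 f2 f3 → ∫ x, x ∂F = 0 →
    variance id F = σ ^ 2 → C ≤ σ → ∀ y : ℝ, |y| ≤ c * σ ^ 2 →
      F.real (Set.Ioi (y + C * (1 + y ^ 2 / σ ^ 2)))
        ≤ (gaussianReal 0 (Real.toNNReal (σ ^ 2))).real (Set.Ici (y + 1)) := by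
  obtain ⟨C, c, hC, hc, H⟩ := core_bound
  refine ⟨C, c, hC, hc, ?_⟩
  intro F f f1 f2 f3 σ hF hN hm0 hvar hσ y hy
  rcases le_total 0 y with h0 | h0
  · rw [abs_of_nonneg h0] at hy
    refine le_trans (measureReal_mono Set.Ioi_subset_Ici_self) (H F f f1 f2 f3 σ hF hN hm0 hvar hσ y h0 hy).1
  · rw [abs_of_nonpos h0] at hy
    obtain ⟨g, g1, g2, g3, hg⟩ := hN.neg
    have := (H _ g g1 g2 g3 σ (map_mul_prob F (-1)) hg (map_mul_mean F _ hm0)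
      (by rw [map_mul_var, hvar]; ring) hσ (-y) (by linarith) hy).2
    rw [refl_Ici, gauss_symm] at this
    have e1 : -(-y - C * (1 + (-y) ^ 2 / σ ^ 2)) = y + C * (1 + y ^ 2 / σ ^ 2) := by ring
    have e2 : -(-y - 1) = y + 1 := by ring
    rw [e1, e2] at this
    rw [Ioi_eq, Ici_eq]
    have h3 : (gaussianReal 0 (Real.toNNReal (σ ^ 2))).real (Set.Iio (y + 1))
        ≤ (gaussianReal 0 (Real.toNNReal (σ ^ 2))).real (Set.Iic (y + 1)) :=
      measureReal_mono Set.Iio_subset_Iic_self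
    linarith

/-- The quantile coupling and its pointwise estimate. -/
lemma quantile_close : ∃ C c : ℝ, 1 ≤ C ∧ 0 < c ∧ ∀ (F : Measure ℝ) (f f1 f2 f3 : ℂ → ℂ) (σ : ℝ),
    IsProbabilityMeasure F → Nice (1 / 16) F f f1 f2 f3 → ∫ x, x ∂F = 0 →
    variance id F = σ ^ 2 → C ≤ σ → ∀ (X Y : ℝ → ℝ),
      (∀ u ∈ Set.Ioo (0 : ℝ) 1, ∀ x, X u ≤ x ↔ u ≤ F.real (Set.Iic x)) →
      (∀ u ∈ Set.Ioo (0 : ℝ) 1, ∀ x, Y u ≤ x ↔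
        u ≤ (gaussianReal 0 (Real.toNNReal (σ ^ 2))).real (Set.Iic x)) →
      ∀ u ∈ Set.Ioo (0 : ℝ) 1, |Y u| ≤ c * σ ^ 2 → |X u - Y u| ≤ C * (1 + Y u ^ 2 / σ ^ 2) := by
  obtain ⟨C, c, hC, hc, H⟩ := two_sided
  refine ⟨C, c, hC, hc, ?_⟩
  intro F f f1 f2 f3 σ hF hN hm0 hvar hσ X Y hX hY u hu hy
  set y := Y u with hyd
  have ha := H F f f1 f2 f3 σ hF hN hm0 hvar hσ y hy
  obtain ⟨g, g1, g2, g3, hg⟩ := hN.neg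
  have hb := H _ g g1 g2 g3 σ (map_mul_prob F (-1)) hg (map_mul_mean F _ hm0)
      (by rw [map_mul_var, hvar]; ring) hσ (-y) (by rwa [abs_neg])
  rw [refl_Ioi, gauss_symm] at hb
  have e1 : -(-y + C * (1 + (-y) ^ 2 / σ ^ 2)) = y - C * (1 + y ^ 2 / σ ^ 2) := by ring
  have e2 : -(-y + 1) = y - 1 := by ring
  rw [e1, e2] at hb
  rw [Ioi_eq, Ici_eq] at ha
  have h3 : (gaussianReal 0 (Real.toNNReal (σ ^ 2))).real (Set.Iic y)
        ≤ (gaussianReal 0 (Real.toNNReal (σ ^ 2))).real (Set.Iio (y + 1)) :=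
      measureReal_mono (Set.Iic_subset_Iio.2 (by linarith))
  have h4 := (hY u hu y).1 le_rfl
  have h5 := (hX u hu (y + C * (1 + y ^ 2 / σ ^ 2))).2 (by linarith)
  have h6 : y - C * (1 + y ^ 2 / σ ^ 2) ≤ X u := by
    by_contra hlt
    have h7 := (hX u hu (X u)).1 le_rfl
    have h8 : F.real (Set.Iic (X u)) ≤ F.real (Set.Iio (y - C * (1 + y ^ 2 / σ ^ 2))) :=
      measureReal_mono (Set.Iic_subset_Iio.2 (not_le.1 hlt))
    have h9 := (hY u hu (y - 1)).2 (by linarith)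
    linarith
  exact abs_le.2 ⟨by linarith, by linarith⟩

lemma exp_abs_le (μ : Measure ℝ) {r B : ℝ} (hr : 0 ≤ r)
    (h1 : Integrable (fun x => Real.exp (r * x)) μ) (h2 : Integrable (fun x => Real.exp (-r * x)) μ)
    (b1 : ∫ x, Real.exp (r * x) ∂μ ≤ B) (b2 : ∫ x, Real.exp (-r * x) ∂μ ≤ B) :
    Integrable (fun x => Real.exp (r * |x|)) μ ∧ ∫ x, Real.exp (r * |x|) ∂μ ≤ 2 * B := by
  have hle : ∀ x : ℝ, Real.exp (r * |x|) ≤ Real.exp (r * x) + Real.exp (-r * x) := by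
    intro x
    rcases abs_cases x with ⟨h, -⟩ | ⟨h, -⟩
    · rw [h]; linarith [Real.exp_pos (-r * x)]
    · rw [h, mul_neg, ← neg_mul]; linarith [Real.exp_pos (r * x)]
  have hi : Integrable (fun x => Real.exp (r * |x|)) μ := by
    refine (h1.add h2).mono' (by fun_prop) (Filter.Eventually.of_forall fun x => ?_)
    rw [Real.norm_eq_abs, abs_of_pos (Real.exp_pos _)]
    exact hle x
  refine ⟨hi, ?_⟩
  calc _ ≤ ∫ x, (Real.exp (r * x) + Real.exp (-r * x)) ∂μ := integral_mono hi (h1.add h2) hle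
    _ = _ := integral_add h1 h2
    _ ≤ _ := by linarith

lemma Nice.exp_bound {F : Measure ℝ} [IsProbabilityMeasure F] {f f1 f2 f3 : ℂ → ℂ}
    (h : Nice (1 / 16) F f f1 f2 f3) (hm : ∫ x, x ∂F = 0) {r : ℝ} (hr : |r| ≤ 1) :
    Integrable (fun x => Real.exp (r * x)) F ∧
      ∫ x, Real.exp (r * x) ∂F ≤ Real.exp (variance id F * r ^ 2) := by
  have hz : ‖(r : ℂ)‖ * (1 / 16) < 1 := by
    rw [Complex.norm_real, Real.norm_eq_abs]; linarith
  have hi := h.int r hz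
  have hi' : Integrable (fun x => Real.exp (r * x)) F := by
    refine hi.norm.congr (Filter.Eventually.of_forall fun x => ?_)
    simp [Complex.norm_exp]
  refine ⟨hi', ?_⟩
  have e0 : Complex.exp (f r) = ((∫ x : ℝ, Real.exp (r * x) ∂F : ℝ) : ℂ) := by
    rw [h.eq r hz, ← integral_complex_ofReal]
    simp
  have e1 : ∫ x : ℝ, Real.exp (r * x) ∂F = Real.exp (f r).re := by
    have := congrArg norm e0
    rw [Complex.norm_exp, Complex.norm_real, Real.norm_eq_abs, abs_of_nonneg] at this
    · exact this.symm
    · exact integral_nonneg fun x => (Real.exp_pos _).le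
  rw [e1, Real.exp_le_exp]
  have ht := (h.taylor (by norm_num) (z := 0) (w := (r : ℂ)) (by simpa using hz)).2.2
  rw [zero_add, h.zero, h.f1_zero (by norm_num) hm, h.f2_zero (by norm_num) hm, sub_zero, zero_mul,
    sub_zero, Complex.norm_real, Real.norm_eq_abs] at ht
  have h2 := (Complex.abs_re_le_norm _).trans ht
  have h3 : (f r - (variance id F : ℂ) * (r : ℂ) ^ 2 / 2).re = (f r).re - variance id F * r ^ 2 / 2 := by
    rw [Complex.sub_re]
    congr 1
    have : (variance id F : ℂ) * (r : ℂ) ^ 2 / 2 = ((variance id F * r ^ 2 / 2 : ℝ) : ℂ) := by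
      push_cast; ring
    rw [this, Complex.ofReal_re]
  rw [h3] at h2
  have h4 := (abs_le.1 h2).2
  have hV : 0 ≤ variance id F := variance_nonneg _ _
  have h5 : |r| ^ 3 ≤ r ^ 2 := by
    rw [← sq_abs r]
    nlinarith [abs_nonneg r, sq_nonneg |r|]
  have h6 : variance id F * |r| ^ 3 ≤ variance id F * r ^ 2 := by gcongr
  have h7 : 0 ≤ variance id F * r ^ 2 := by positivity
  linarith

lemma Nice.exp_abs {F : Measure ℝ} [IsProbabilityMeasure F] {f f1 f2 f3 : ℂ → ℂ}
    (h : Nice (1 / 16) F f f1 f2 f3) (hm : ∫ x, x ∂F = 0) {r : ℝ} (hr0 : 0 ≤ r) (hr : r ≤ 1) :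
    Integrable (fun x => Real.exp (r * |x|)) F ∧
      ∫ x, Real.exp (r * |x|) ∂F ≤ 2 * Real.exp (variance id F * r ^ 2) := by
  have h1 := h.exp_bound hm (r := r) (by rwa [abs_of_nonneg hr0])
  have h2 := h.exp_bound hm (r := -r) (by rwa [abs_neg, abs_of_nonneg hr0])
  rw [neg_sq] at h2
  exact exp_abs_le F hr0 h1.1 h2.1 h1.2 h2.2

lemma gauss_exp_abs (v : NNReal) {r : ℝ} (hr0 : 0 ≤ r) :
    Integrable (fun x => Real.exp (r * |x|)) (gaussianReal 0 v) ∧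
      ∫ x, Real.exp (r * |x|) ∂(gaussianReal 0 v) ≤ 2 * Real.exp (v * r ^ 2 / 2) := by
  have hm : ∀ t, ∫ x, Real.exp (t * x) ∂(gaussianReal 0 v) = Real.exp (v * t ^ 2 / 2) := by
    intro t
    have := congrFun (mgf_id_gaussianReal (μ := 0) (v := v)) t
    rw [mgf] at this
    simpa using this
  refine exp_abs_le _ hr0 (integrable_exp_mul_gaussianReal r) (integrable_exp_mul_gaussianReal (-r))
    (hm r).le ?_
  rw [hm, neg_sq]

lemma gauss_sq_int : Integrable (fun z : ℝ => Real.exp (z ^ 2 / 4)) (gaussianReal 0 1) := by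
  rw [gaussianReal_of_var_ne_zero _ one_ne_zero]
  unfold gaussianPDF
  rw [integrable_withDensity_iff_integrable_smul' (by fun_prop)
    (Filter.Eventually.of_forall fun z => ENNReal.ofReal_lt_top)]
  have h := (integrable_exp_neg_mul_sq (b := 1 / 4) (by norm_num)).const_mul (Real.sqrt (2 * Real.pi))⁻¹
  refine h.congr (Filter.Eventually.of_forall fun z => ?_)
  simp only
  rw [ENNReal.toReal_ofReal (gaussianPDFReal_nonneg _ _ _), smul_eq_mul]
  have hg := gpdf_eq 0 (one_pos : (0 : ℝ) < 1) z
  rw [one_pow, Real.toNNReal_one] at hg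
  rw [hg, inv_one, mul_one, mul_assoc, ← Real.exp_add]
  congr 2
  ring

lemma gauss_sq {σ : ℝ} (hσ : 0 < σ) :
    Integrable (fun x : ℝ => Real.exp (x ^ 2 / (4 * σ ^ 2))) (gaussianReal 0 (Real.toNNReal (σ ^ 2))) ∧
    ∫ x : ℝ, Real.exp (x ^ 2 / (4 * σ ^ 2)) ∂(gaussianReal 0 (Real.toNNReal (σ ^ 2)))
      = ∫ z : ℝ, Real.exp (z ^ 2 / 4) ∂(gaussianReal 0 1) := by
  have e : ∀ z : ℝ, (0 + σ * z) ^ 2 / (4 * σ ^ 2) = z ^ 2 / 4 := by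
    intro z
    field_simp
    ring
  rw [← gauss_map 0 hσ]
  constructor
  · rw [integrable_map_measure (by fun_prop) (by fun_prop)]
    refine gauss_sq_int.congr (Filter.Eventually.of_forall fun z => ?_)
    simp only [Function.comp, e]
  · rw [integral_map (by fun_prop) (by fun_prop)]
    simp only [e]

set_option maxHeartbeats 1000000 in
lemma normalized : ∃ l B : ℝ, 0 < l ∧ 0 < B ∧ ∀ (F : Measure ℝ) (f f1 f2 f3 : ℂ → ℂ),
    IsProbabilityMeasure F → Nice (1 / 16) F f f1 f2 f3 → ∫ x, x ∂F = 0 →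
    ∃ π : Measure (ℝ × ℝ), IsProbabilityMeasure π ∧
      IsCoupling π F (gaussianReal 0 (Real.toNNReal (variance id F))) ∧
      Integrable (fun p : ℝ × ℝ => Real.exp (l * |p.1 - p.2|)) π ∧
      ∫ p : ℝ × ℝ, Real.exp (l * |p.1 - p.2|) ∂π ≤ B := by
  obtain ⟨C, c₀, hC, hc₀, H⟩ := quantile_close
  set K := ∫ z : ℝ, Real.exp (z ^ 2 / 4) ∂(gaussianReal 0 1) with hK
  have hK0 : 0 ≤ K := integral_nonneg fun z => (Real.exp_pos _).le
  set c := min c₀ 1 with hc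
  have hc0 : 0 < c := lt_min hc₀ one_pos
  have hc1 : c ≤ 1 := min_le_right _ _
  have hcc : c ≤ c₀ := min_le_left _ _
  set l := min (c / 8) (1 / (4 * C)) with hl
  have hl0 : 0 < l := lt_min (by positivity) (by positivity)
  have hl1 : l ≤ c / 8 := min_le_left _ _
  have hl2 : l * C ≤ 1 / 4 := by
    have : l ≤ 1 / (4 * C) := min_le_right _ _
    rw [le_div_iff₀ (by positivity)] at this
    linarith
  clear_value l c
  have hexp : 0 < Real.exp 1 := Real.exp_pos _
  refine ⟨l, Real.exp 1 * K + 4 * Real.exp 1 + 4, hl0, by positivity, ?_⟩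
  intro F f f1 f2 f3 hF hN hm0
  set V := variance id F with hV
  have hV0 : 0 ≤ V := variance_nonneg _ _
  set σ := Real.sqrt V with hσ
  have hσV : V = σ ^ 2 := (Real.sq_sqrt hV0).symm
  have hσ0 : 0 ≤ σ := Real.sqrt_nonneg _
  set G := gaussianReal 0 (Real.toNNReal V) with hG
  obtain ⟨X, hXm, hXF, hX⟩ := quantile_exists F
  obtain ⟨Y, hYm, hYG, hY⟩ := quantile_exists G
  set P := volume.restrict (Set.Ioo (0 : ℝ) 1) with hP
  have hPp : IsProbabilityMeasure P := ⟨by simp [hP]⟩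
  have hXY : AEMeasurable (fun u => (X u, Y u)) P := hXm.prodMk hYm
  have gF : ∀ {r : ℝ}, 0 ≤ r → r ≤ 1 → Integrable (fun u => Real.exp (r * |X u|)) P ∧
      ∫ u, Real.exp (r * |X u|) ∂P ≤ 2 * Real.exp (V * r ^ 2) := by
    intro r h0 h1
    have h := hN.exp_abs hm0 h0 h1
    rw [← hXF] at h
    rw [integrable_map_measure (by fun_prop) hXm, integral_map hXm (by fun_prop), hXF] at h
    exact h
  have gG : ∀ {r : ℝ}, 0 ≤ r → Integrable (fun u => Real.exp (r * |Y u|)) P ∧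
      ∫ u, Real.exp (r * |Y u|) ∂P ≤ 2 * Real.exp (V * r ^ 2 / 2) := by
    intro r h0
    have h := gauss_exp_abs (Real.toNNReal V) h0
    rw [← hG, ← hYG, Real.coe_toNNReal _ hV0] at h
    rw [integrable_map_measure (by fun_prop) hYm, integral_map hYm (by fun_prop)] at h
    exact h
  have main : ∃ d : ℝ → ℝ, Integrable d P ∧ ∫ u, d u ∂P ≤ Real.exp 1 * K + 4 * Real.exp 1 + 4 ∧
      ∀ u ∈ Set.Ioo (0 : ℝ) 1, Real.exp (l * |X u - Y u|) ≤ d u := by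
    have prod_le : ∀ a b : ℝ, Real.exp (a + b) ≤ Real.exp (2 * a) + Real.exp (2 * b) := by
      intro a b
      rw [Real.exp_add, two_mul, two_mul, Real.exp_add, Real.exp_add]
      nlinarith [sq_nonneg (Real.exp a - Real.exp b), Real.exp_pos a, Real.exp_pos b]
    have tri : ∀ u, l * |X u - Y u| ≤ l * |X u| + l * |Y u| := by
      intro u
      rw [← mul_add]
      exact mul_le_mul_of_nonneg_left (abs_sub _ _) hl0.le
    rcases le_total C σ with hbig | hsmall
    · have hσp : 0 < σ := by linarith
      have gq := gauss_sq hσp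
      rw [← hσV, ← hG, ← hYG, ← hK] at gq
      rw [integrable_map_measure (by fun_prop) hYm, integral_map hYm (by fun_prop)] at gq
      have g1 := gF (r := 2 * l) (by linarith) (by linarith)
      have g2 := gG (r := 2 * (l + c / 8)) (by linarith)
      have i1 : Integrable (fun u => Real.exp 1 * Real.exp (Y u ^ 2 / (4 * V))) P :=
        gq.1.const_mul (Real.exp 1)
      have i2 : Integrable (fun u => Real.exp (-(c / 8 * (c * V))) *
          (Real.exp (2 * l * |X u|) + Real.exp (2 * (l + c / 8) * |Y u|))) P := (g1.1.add g2.1).const_mul (Real.exp (-(c / 8 * (c * V))))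
      refine ⟨fun u => Real.exp 1 * Real.exp (Y u ^ 2 / (4 * V)) + Real.exp (-(c / 8 * (c * V))) *
        (Real.exp (2 * l * |X u|) + Real.exp (2 * (l + c / 8) * |Y u|)), i1.add i2, ?_, ?_⟩
      · rw [integral_add i1 i2, integral_const_mul, integral_const_mul, gq.2,
          integral_add g1.1 g2.1]
        have b1 : V * (2 * l) ^ 2 ≤ c / 8 * (c * V) := by
          have : (2 * l) ^ 2 ≤ (2 * (c / 8)) ^ 2 := by gcongr
          nlinarith [mul_nonneg hV0 (sq_nonneg c)]
        have b2 : V * (2 * (l + c / 8)) ^ 2 / 2 ≤ c / 8 * (c * V) := by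
          have : (2 * (l + c / 8)) ^ 2 ≤ (2 * (c / 8 + c / 8)) ^ 2 := by gcongr
          nlinarith [mul_nonneg hV0 (sq_nonneg c)]
        have : Real.exp (-(c / 8 * (c * V))) * ((∫ u, Real.exp (2 * l * |X u|) ∂P)
            + ∫ u, Real.exp (2 * (l + c / 8) * |Y u|) ∂P)
            ≤ Real.exp (-(c / 8 * (c * V))) * (2 * Real.exp (c / 8 * (c * V)) + 2 * Real.exp (c / 8 * (c * V))) := by
          refine mul_le_mul_of_nonneg_left (add_le_add ?_ ?_) (Real.exp_pos _).le
          · exact g1.2.trans (by gcongr)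
          · exact g2.2.trans (by gcongr)
        have e : Real.exp (-(c / 8 * (c * V))) * (2 * Real.exp (c / 8 * (c * V)) + 2 * Real.exp (c / 8 * (c * V))) = 4 := by
          have : Real.exp (-(c / 8 * (c * V))) * Real.exp (c / 8 * (c * V)) = 1 := by
            rw [← Real.exp_add]; simp
          linear_combination 4 * this
        linarith
      · intro u hu
        rcases le_total |Y u| (c * V) with h | h
        · have hq := H F f f1 f2 f3 σ hF hN hm0 hσV hbig X Y hX (by rw [← hσV]; exact hY) u hu
            (by rw [← hσV]; exact h.trans (mul_le_mul_of_nonneg_right hcc hV0))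
          rw [← hσV] at hq
          have h1 : l * |X u - Y u| ≤ 1 + Y u ^ 2 / (4 * V) := by
            have q0 : 0 ≤ Y u ^ 2 / V := by positivity
            calc l * |X u - Y u| ≤ l * (C * (1 + Y u ^ 2 / V)) := by gcongr
              _ = l * C * (1 + Y u ^ 2 / V) := by ring
              _ ≤ 1 / 4 * (1 + Y u ^ 2 / V) := by gcongr
              _ = 1 / 4 + Y u ^ 2 / (4 * V) := by ring
              _ ≤ _ := by linarith
          have h2 : 0 ≤ Real.exp (-(c / 8 * (c * V))) *
            (Real.exp (2 * l * |X u|) + Real.exp (2 * (l + c / 8) * |Y u|)) := by positivity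
          have h3 : Real.exp (l * |X u - Y u|) ≤ Real.exp 1 * Real.exp (Y u ^ 2 / (4 * V)) := by
            rw [← Real.exp_add]
            exact Real.exp_le_exp.2 h1
          linarith
        · have h1 : l * |X u - Y u| ≤ -(c / 8 * (c * V)) + (l * |X u| + (l + c / 8) * |Y u|) := by
            have := tri u
            have : c / 8 * (c * V) ≤ c / 8 * |Y u| := by gcongr
            linarith
          have h2 : 0 ≤ Real.exp 1 * Real.exp (Y u ^ 2 / (4 * V)) := by positivity
          have h3 : Real.exp (l * |X u - Y u|) ≤ Real.exp (-(c / 8 * (c * V))) *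
            (Real.exp (2 * l * |X u|) + Real.exp (2 * (l + c / 8) * |Y u|)) := by
            refine (Real.exp_le_exp.2 h1).trans ?_
            rw [Real.exp_add]
            refine mul_le_mul_of_nonneg_left ?_ (Real.exp_pos _).le
            have := prod_le (l * |X u|) ((l + c / 8) * |Y u|)
            rwa [← mul_assoc, ← mul_assoc] at this
          linarith
    · have g1 := gF (r := 2 * l) (by linarith) (by linarith)
      have g2 := gG (r := 2 * l) (by linarith)
      refine ⟨fun u => Real.exp (2 * l * |X u|) + Real.exp (2 * l * |Y u|), g1.1.add g2.1, ?_, ?_⟩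
      · rw [integral_add g1.1 g2.1]
        have b0 : V * (2 * l) ^ 2 ≤ 1 := by
          have : l * σ ≤ 1 / 4 := (mul_le_mul_of_nonneg_left hsmall hl0.le).trans hl2
          have h0 : 0 ≤ l * σ := by positivity
          rw [hσV]
          nlinarith
        have b0' : 0 ≤ V * (2 * l) ^ 2 := by positivity
        have b1 : Real.exp (V * (2 * l) ^ 2) ≤ Real.exp 1 := Real.exp_le_exp.2 b0
        have b2 : Real.exp (V * (2 * l) ^ 2 / 2) ≤ Real.exp 1 := Real.exp_le_exp.2 (by linarith)
        have : 0 ≤ Real.exp 1 * K := by positivity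
        linarith [g1.2, g2.2]
      · intro u hu
        refine (Real.exp_le_exp.2 (tri u)).trans ?_
        have := prod_le (l * |X u|) (l * |Y u|)
        rwa [← mul_assoc, ← mul_assoc] at this
  obtain ⟨d, hd, hdB, hdu⟩ := main
  have hdu' : ∀ᵐ u ∂P, Real.exp (l * |X u - Y u|) ≤ d u := by
    filter_upwards [ae_restrict_mem measurableSet_Ioo] with u hu using hdu u hu
  have hint : Integrable (fun u => Real.exp (l * |X u - Y u|)) P := by
    refine hd.mono' ?_ ?_
    · have : AEMeasurable (fun u => Real.exp (l * |X u - Y u|)) P := by fun_prop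
      exact this.aestronglyMeasurable
    · filter_upwards [hdu'] with u hu
      rwa [Real.norm_eq_abs, abs_of_pos (Real.exp_pos _)]
  refine ⟨P.map (fun u => (X u, Y u)), Measure.isProbabilityMeasure_map hXY, ⟨?_, ?_⟩, ?_, ?_⟩
  · rw [AEMeasurable.map_map_of_aemeasurable (by fun_prop) hXY]
    exact hXF
  · rw [AEMeasurable.map_map_of_aemeasurable (by fun_prop) hXY]
    exact hYG
  · rw [integrable_map_measure (by fun_prop) hXY]
    exact hint
  · rw [integral_map hXY (by fun_prop)]
    exact (integral_mono_ae hint hd hdu').trans hdB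


/-- Theorem 1 (main theorem): there is an absolute constant `c₁` such that for every `τ > 0`
and every mean-zero distribution `F ∈ A₁(τ)` there is a coupling `π` of `F` and the Gaussian
law `Φ_F` (with the same mean and variance) with `∫ exp(|x - y|/(c₁ τ)) dπ ≤ c₁`. -/
theorem transport_estimate_A1 :
    ∃ c₁ : ℝ, 0 < c₁ ∧
      ∀ (τ : ℝ), 0 < τ →
        ∀ (F : Measure ℝ), IsProbabilityMeasure F → (∫ x : ℝ, x ∂F) = 0 → MemA1 τ F →
          ∃ π : Measure (ℝ × ℝ), IsProbabilityMeasure π ∧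
            IsCoupling π F (gaussianReal 0 (Real.toNNReal (variance id F))) ∧
            ∫ p : ℝ × ℝ, Real.exp (|p.1 - p.2| / (c₁ * τ)) ∂π ≤ c₁ := by
  obtain ⟨l, B, hl, hB, H⟩ := normalized
  have hc₁ : 0 < max (16 / l) B := lt_max_of_lt_right hB
  refine ⟨max (16 / l) B, hc₁, ?_⟩
  intro τ hτ F hF hm hA
  obtain ⟨φ, hφ⟩ := hA
  set a : ℝ := 1 / (16 * τ) with ha
  set b : ℝ := 16 * τ with hb
  have hb0 : 0 < b := by positivity
  have ha0 : 0 < a := by positivity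
  have hba : b * a = 1 := by rw [ha]; field_simp
  have hN := hφ.nice.scale a ha0.ne'
  have haτ : |a| * τ = 1 / 16 := by
    rw [abs_of_pos ha0, ha, hb]; field_simp
  rw [haτ] at hN
  obtain ⟨π, hπ, ⟨hπ1, hπ2⟩, hint, hle⟩ := H (F.map (fun x => a * x)) _ _ _ _ (map_mul_prob F a) hN
    (map_mul_mean F a hm)
  have hmeas : Measurable (fun p : ℝ × ℝ => (b * p.1, b * p.2)) := by fun_prop
  refine ⟨π.map (fun p => (b * p.1, b * p.2)), Measure.isProbabilityMeasure_map hmeas.aemeasurable,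
    ⟨?_, ?_⟩, ?_⟩
  · rw [Measure.map_map (by fun_prop) hmeas]
    have : (Prod.fst ∘ fun p : ℝ × ℝ => (b * p.1, b * p.2)) = (fun x => b * x) ∘ Prod.fst := rfl
    rw [this, ← Measure.map_map (by fun_prop) (by fun_prop), hπ1, Measure.map_map (by fun_prop) (by fun_prop)]
    have : ((fun x => b * x) ∘ fun x => a * x) = (id : ℝ → ℝ) := by
      ext x
      simp [← mul_assoc, hba]
    rw [this, Measure.map_id]
  · rw [Measure.map_map (by fun_prop) hmeas]
    have : (Prod.snd ∘ fun p : ℝ × ℝ => (b * p.1, b * p.2)) = (fun x => b * x) ∘ Prod.snd := rfl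
    rw [this, ← Measure.map_map (by fun_prop) (by fun_prop), hπ2, gaussianReal_map_const_mul, mul_zero,
      map_mul_var]
    congr 1
    have hV : 0 ≤ variance id F := variance_nonneg _ _
    ext
    rw [NNReal.coe_mul, NNReal.coe_mk, Real.coe_toNNReal _ (by positivity), Real.coe_toNNReal _ hV,
      ← mul_assoc, ← mul_pow, hba]
    ring
  · rw [integral_map hmeas.aemeasurable (by fun_prop)]
    refine le_trans (integral_mono_of_nonneg (Filter.Eventually.of_forall fun p => (Real.exp_pos _).le)
      hint (Filter.Eventually.of_forall fun p => ?_)) (hle.trans (le_max_right _ _))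
    simp only
    rw [Real.exp_le_exp, ← mul_sub, abs_mul, abs_of_pos hb0, div_le_iff₀ (by positivity)]
    have h1 : 16 ≤ l * max (16 / l) B := by
      have h2 : l * (16 / l) = 16 := by field_simp
      have h3 : l * (16 / l) ≤ l * max (16 / l) B :=
        mul_le_mul_of_nonneg_left (le_max_left _ _) hl.le
      linarith
    calc b * |p.1 - p.2| = 16 * (τ * |p.1 - p.2|) := by rw [hb]; ring
      _ ≤ l * max (16 / l) B * (τ * |p.1 - p.2|) := by gcongr
      _ = _ := by ring
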